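/- arXiv:2411.02222 — 8 statements merged into one kernel-verified Lean document; each statement's English description precedes it below -/
import Mathlib

section
/- Fix integers p, q ≥ 1 and set n = p + q + 1. The group homomorphism φ from the free group F(x, y) on two generators x, y to the braid group B_{n+2} determined by φ(x) = σ_1 σ_2 ⋯ σ_{p+1} · σ_1 and φ(y) = σ_{p+2} σ_{p+3} ⋯ σ_{n+1} · σ_{p+2} is not injective. -/
/-- The braid relations on `m - 1` generators: `PresentedGroup (braidRels m)` is the braid
group `B_m`.  The generator `i : Fin (m - 1)` corresponds to the standard generator
`σ_{i+1}` (in the usual 1-based numbering `σ_1, …, σ_{m-1}`). -/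
def braidRels (m : ℕ) : Set (FreeGroup (Fin (m - 1))) :=
  {r | (∃ i j : Fin (m - 1), (i : ℕ) + 1 = (j : ℕ) ∧
          r = FreeGroup.of i * FreeGroup.of j * FreeGroup.of i *
              (FreeGroup.of j * FreeGroup.of i * FreeGroup.of j)⁻¹) ∨
       (∃ i j : Fin (m - 1), (i : ℕ) + 2 ≤ (j : ℕ) ∧
          r = FreeGroup.of i * FreeGroup.of j * (FreeGroup.of j * FreeGroup.of i)⁻¹)}

/-- The braid group on `m` strands, presented by generators `σ_1, …, σ_{m-1}` with the braid
relations. -/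
def BraidGroup (m : ℕ) : Type := PresentedGroup (braidRels m)

instance (m : ℕ) : Group (BraidGroup m) := by unfold BraidGroup; infer_instance

/-- The standard generator `σ_j` of `B_m`, for `1 ≤ j ≤ m - 1` (and junk value `1` otherwise). -/
def σ (m j : ℕ) : BraidGroup m :=
  if h : 1 ≤ j ∧ j ≤ m - 1 then PresentedGroup.of ⟨j - 1, by omega⟩ else 1

/-- `σ_{[i,j]} = σ_i σ_{i+1} ⋯ σ_j` if `i ≤ j`, and `1` if `i > j`. -/
def σI (m i j : ℕ) : BraidGroup m := ((List.range' i (j + 1 - i)).map (σ m)).prod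

/-- `σ̄_{[i,j]} = σ_j σ_{j-1} ⋯ σ_i` if `i ≤ j`, and `1` if `i > j`. -/
def σIrev (m i j : ℕ) : BraidGroup m := ((List.range' i (j + 1 - i)).reverse.map (σ m)).prod

/-- The Dehn twist braid `twist_k = (σ_{[1,k-1]} σ_1)^{k-1}`. -/
def twist (m k : ℕ) : BraidGroup m := (σI m 1 (k - 1) * σ m 1) ^ (k - 1)

/-- The point-push braid `push_k = σ̄_{[1,k-1]} σ_{[1,k-1]}`. -/
def push (m k : ℕ) : BraidGroup m := σIrev m 1 (k - 1) * σI m 1 (k - 1)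

section AbstractGroup

variable {G : Type*} [Group G]

lemma comm_x {a b : G} (h : a * b * a = b * a * b) :
    Commute (a * b * a * (a * b * a)) a ∧ Commute (a * b * a * (a * b * a)) b := by
  have h1 : (a * b * a) * a = b * (a * b * a) := by
    calc (a * b * a) * a = (b * a * b) * a := by rw [h]
      _ = b * (a * b * a) := by simp only [mul_assoc]
  have h2 : (a * b * a) * b = a * (a * b * a) := by
    calc (a * b * a) * b = a * (b * a * b) := by simp only [mul_assoc]
      _ = a * (a * b * a) := by rw [h]
  refine ⟨?_, ?_⟩
  · show _ * a = a * _
    rw [mul_assoc, h1, ← mul_assoc, h2, mul_assoc]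
  · show _ * b = b * _
    rw [mul_assoc, h2, ← mul_assoc, h1, mul_assoc]

/-- The point push commutes with the inner generators. -/
lemma comm_push {a b c : G} (hab : a * b * a = b * a * b) (hac : a * c * a = c * a * c)
    (hbc : b * c = c * b) :
    Commute (c * a * b * b * a * c) a ∧ Commute (c * a * b * b * a * c) b := by
  refine ⟨?_, ?_⟩
  · show _ * a = a * _
    calc (c * a * b * b * a * c) * a = c * a * b * b * (a * c * a) := by simp only [mul_assoc]
      _ = c * a * b * (b * c) * a * c := by rw [hac]; simp only [mul_assoc]
      _ = c * a * (b * c) * b * a * c := by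
          conv_lhs => rw [hbc]
          simp only [mul_assoc]
      _ = (c * a * c) * b * b * a * c := by rw [hbc]; simp only [mul_assoc]
      _ = a * (c * a * b * b * a * c) := by rw [← hac]; simp only [mul_assoc]
  · show _ * b = b * _
    calc (c * a * b * b * a * c) * b = c * a * b * b * a * (c * b) := by simp only [mul_assoc]
      _ = c * a * b * (b * a * b) * c := by rw [← hbc]; simp only [mul_assoc]
      _ = c * (a * b * a) * b * a * c := by rw [← hab]; simp only [mul_assoc]
      _ = (c * b) * a * b * b * a * c := by rw [hab]; simp only [mul_assoc]
      _ = b * (c * a * b * b * a * c) := by rw [← hbc]; simp only [mul_assoc]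

lemma comm_Q {a b c : G} (hab : a * b * a = b * a * b) (hac : a * c * a = c * a * c)
    (hbc : b * c = c * b) :
    Commute (a * b * a * (a * b * a)) (c * (a * b * a) * c⁻¹ * (a * b * a) * c) := by
  have hCA : c⁻¹ * a⁻¹ * c = a * c⁻¹ * a⁻¹ := by
    have : c * a * (c⁻¹ * a⁻¹ * c) * (a * c) = c * a * (a * c⁻¹ * a⁻¹) * (a * c) := by
      calc c * a * (c⁻¹ * a⁻¹ * c) * (a * c) = c * a * c⁻¹ * a⁻¹ * (c * a * c) := by
            simp only [mul_assoc]
        _ = c * a * a := by rw [← hac]; group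
        _ = c * a * (a * c⁻¹ * a⁻¹) * (a * c) := by group
    exact mul_left_cancel (mul_right_cancel this)
  have hbC : b * c⁻¹ = c⁻¹ * b := (Commute.inv_right (show Commute b c from hbc))
  have hQ : c * (a * b * a) * c⁻¹ * (a * b * a) * c
      = b * a⁻¹ * b * (c * a * b * b * a * c) := by
    symm
    calc b * a⁻¹ * b * (c * a * b * b * a * c)
        = b * a⁻¹ * (b * c) * a * b * b * a * c := by simp only [mul_assoc]
      _ = c * (c⁻¹ * b) * a⁻¹ * c * b * a * b * b * a * c := by rw [hbc]; group
      _ = c * b * (c⁻¹ * a⁻¹ * c) * (b * a * b) * b * a * c := by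
          rw [← hbC]; simp only [mul_assoc]
      _ = c * b * a * (c⁻¹ * b) * a * b * a * c := by rw [hCA, ← hab]; group
      _ = c * (b * a * b) * c⁻¹ * (a * b * a) * c := by rw [← hbC]; simp only [mul_assoc]
      _ = c * (a * b * a) * c⁻¹ * (a * b * a) * c := by rw [← hab]
  rw [hQ]
  obtain ⟨hxa, hxb⟩ := comm_x hab
  obtain ⟨hpa, hpb⟩ := comm_push hab hac hbc
  refine Commute.mul_right ((hxb.mul_right hxa.inv_right).mul_right hxb) ?_
  exact Commute.mul_left ((hpa.symm.mul_left hpb.symm).mul_left hpa.symm)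
    ((hpa.symm.mul_left hpb.symm).mul_left hpa.symm)

/-- The relation for `p, q ≥ 2`, in abstract form. -/
lemma main_rel {a c K L : G} (hac : a * c * a = c * a * c) (hKL : Commute K L)
    (hKc : Commute K c) (hLa : Commute L a)
    (h1 : Commute (c * a * c⁻¹) (K * a * K⁻¹))
    (h2 : Commute (a * c * a⁻¹) (L * c * L⁻¹)) :
    (K * a) ^ 2 * (c * L) * ((K * a) ^ 2)⁻¹ * ((c * L) * (K * a) * (c * L)⁻¹)
      = (c * L) ^ 2 * (K * a) * ((c * L) ^ 2)⁻¹ * ((K * a) * (c * L) * (K * a)⁻¹) := by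
  -- conjugates by `K` and `L`
  set e1 := K * a * K⁻¹ with he1
  set e2 := K * e1 * K⁻¹ with he2
  set f1 := L * c * L⁻¹ with hf1
  have kc : ∀ z : G, K * (z * c * z⁻¹) * K⁻¹ = (K * z * K⁻¹) * c * (K * z * K⁻¹)⁻¹ := by
    intro z
    have : c = K * c * K⁻¹ := by rw [hKc.eq]; group
    conv_rhs => rw [this]
    group
  have conjc : ∀ {u v g : G}, Commute u v → Commute (g * u * g⁻¹) (g * v * g⁻¹) := by
    intro u v g h
    exact (Commute.conj_iff g).2 h
  have cK : K * c * K⁻¹ = c := by rw [hKc.eq]; group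
  have f1K : K * f1 * K⁻¹ = f1 := by
    have hKf : Commute K f1 := (hKL.mul_right hKc).mul_right hKL.inv_right
    rw [hKf.eq]; group
  have aL : L * a * L⁻¹ = a := by rw [hLa.eq]; group
  have braid_conj : ∀ {u v : G}, u * v * u = v * u * v → u * v * u⁻¹ = v⁻¹ * u * v := by
    intro u v h
    have : v * (u * v * u⁻¹) * u = v * (v⁻¹ * u * v) * u := by
      calc v * (u * v * u⁻¹) * u = v * u * v := by group
        _ = u * v * u := h.symm
        _ = _ := by group
    exact mul_left_cancel (mul_right_cancel this)
  have conjb : ∀ {u v : G} (g : G), u * v * u = v * u * v →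
      (g * u * g⁻¹) * (g * v * g⁻¹) * (g * u * g⁻¹)
        = (g * v * g⁻¹) * (g * u * g⁻¹) * (g * v * g⁻¹) := by
    intro u v g h
    calc (g * u * g⁻¹) * (g * v * g⁻¹) * (g * u * g⁻¹) = g * (u * v * u) * g⁻¹ := by group
      _ = g * (v * u * v) * g⁻¹ := by rw [h]
      _ = _ := by group
  -- braid relations
  have b1 : e1 * c * e1 = c * e1 * c := by
    have := conjb K hac; rwa [cK] at this
  have b2 : e2 * c * e2 = c * e2 * c := by
    have := conjb K b1; rwa [cK] at this
  have b3 : a * f1 * a = f1 * a * f1 := by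
    have := conjb L hac; rwa [aL] at this
  have b4 : e1 * f1 * e1 = f1 * e1 * f1 := by
    have := conjb K b3; rwa [f1K] at this
  -- commutations
  have c1 : Commute e1 (e2 * c * e2⁻¹) := by
    have h : Commute (c * e1 * c⁻¹) e2 := by
      have := conjc (g := K) h1
      have e : K * (c * a * c⁻¹) * K⁻¹ = c * e1 * c⁻¹ := by
        calc K * (c * a * c⁻¹) * K⁻¹ = (K * c * K⁻¹) * (K * a * K⁻¹) * (K * c * K⁻¹)⁻¹ := by group
          _ = _ := by rw [cK]
      rwa [e] at this
    have := conjc (g := c⁻¹) h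
    rw [braid_conj b2]
    convert this using 1 <;> group
  have c2' : Commute (e1 * c * e1⁻¹) f1 := by
    have := conjc (g := K) h2
    rwa [f1K, kc] at this
  have c2 : Commute c (f1 * e1 * f1⁻¹) := by
    have := conjc (g := e1⁻¹) c2'
    rw [braid_conj b4.symm]
    convert this using 1 <;> group
  have c3' : Commute (e2 * c * e2⁻¹) f1 := by
    have := conjc (g := K) c2'
    rwa [f1K, kc] at this
  have c3 : Commute (e2 * c * e2⁻¹) (f1 * e1 * f1⁻¹) :=
    (c3'.mul_right c1.symm).mul_right c3'.inv_right
  have key : e1 * e2 * c * e2⁻¹ * e1⁻¹ * f1 * e1 * f1⁻¹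
      = c * f1 * e1 * f1⁻¹ * c⁻¹ * e2 * c * e2⁻¹ := by
    calc e1 * e2 * c * e2⁻¹ * e1⁻¹ * f1 * e1 * f1⁻¹
        = (e1 * (e2 * c * e2⁻¹)) * e1⁻¹ * (f1 * e1 * f1⁻¹) := by group
      _ = (e2 * c * e2⁻¹) * (f1 * e1 * f1⁻¹) := by rw [c1.eq]; group
      _ = (f1 * e1 * f1⁻¹) * (e2 * c * e2⁻¹) := c3.eq
      _ = ((f1 * e1 * f1⁻¹) * c) * c⁻¹ * (e2 * c * e2⁻¹) := by group
      _ = (c * (f1 * e1 * f1⁻¹)) * c⁻¹ * (e2 * c * e2⁻¹) := by rw [c2.eq]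
      _ = _ := by group
  -- the four factors
  have cLe1 : Commute L e1 := (hKL.symm.mul_right hLa).mul_right hKL.symm.inv_right
  have x1 : K * a = e1 * K := by rw [he1]; group
  have hmK : K * (e1 * c * e1⁻¹) = e2 * c * e2⁻¹ * K := by
    have := kc e1
    rw [← he2] at this
    rw [← this]; group
  have hmL : L * (c * e1 * c⁻¹) = f1 * e1 * f1⁻¹ * L := by
    have : L * e1 * L⁻¹ = e1 := by rw [cLe1.eq]; group
    calc L * (c * e1 * c⁻¹) = f1 * (L * e1 * L⁻¹) * f1⁻¹ * L := by rw [hf1]; group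
      _ = _ := by rw [this]
  have t1 : (K * a) * (c * L) * (K * a)⁻¹ = e1 * c * e1⁻¹ * L := by
    calc (K * a) * (c * L) * (K * a)⁻¹ = e1 * (K * (c * L)) * K⁻¹ * e1⁻¹ := by rw [x1]; group
      _ = e1 * c * (L * e1⁻¹) := by rw [(hKc.mul_right hKL).eq]; group
      _ = e1 * c * e1⁻¹ * L := by rw [cLe1.inv_right.eq]; group
  have t2 : (K * a) ^ 2 * (c * L) * ((K * a) ^ 2)⁻¹ = e1 * e2 * c * e2⁻¹ * e1⁻¹ * L := by
    calc (K * a) ^ 2 * (c * L) * ((K * a) ^ 2)⁻¹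
        = (K * a) * ((K * a) * (c * L) * (K * a)⁻¹) * (K * a)⁻¹ := by
          rw [pow_two]; group
      _ = e1 * (K * (e1 * c * e1⁻¹)) * (L * K⁻¹) * e1⁻¹ := by rw [t1, x1]; group
      _ = e1 * e2 * c * e2⁻¹ * (L * e1⁻¹) := by rw [hmK, hKL.symm.inv_right.eq]; group
      _ = _ := by rw [cLe1.inv_right.eq]; group
  have t3 : (c * L) * (K * a) * (c * L)⁻¹ = c * e1 * c⁻¹ * K := by
    calc (c * L) * (K * a) * (c * L)⁻¹ = c * (L * (e1 * K)) * L⁻¹ * c⁻¹ := by rw [x1]; group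
      _ = c * e1 * (K * c⁻¹) := by rw [(cLe1.mul_right hKL.symm).eq]; group
      _ = _ := by rw [hKc.inv_right.eq]; group
  have t4 : (c * L) ^ 2 * (K * a) * ((c * L) ^ 2)⁻¹ = c * f1 * e1 * f1⁻¹ * c⁻¹ * K := by
    calc (c * L) ^ 2 * (K * a) * ((c * L) ^ 2)⁻¹
        = (c * L) * ((c * L) * (K * a) * (c * L)⁻¹) * (c * L)⁻¹ := by
          rw [pow_two]; group
      _ = c * (L * (c * e1 * c⁻¹)) * (K * L⁻¹) * c⁻¹ := by rw [t3]; group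
      _ = c * f1 * e1 * f1⁻¹ * (K * c⁻¹) := by rw [hmL, hKL.inv_right.eq]; group
      _ = _ := by rw [hKc.inv_right.eq]; group
  rw [t1, t2, t3, t4]
  calc e1 * e2 * c * e2⁻¹ * e1⁻¹ * L * (c * e1 * c⁻¹ * K)
      = e1 * e2 * c * e2⁻¹ * e1⁻¹ * (L * (c * e1 * c⁻¹)) * K := by simp only [mul_assoc]
    _ = (e1 * e2 * c * e2⁻¹ * e1⁻¹ * f1 * e1 * f1⁻¹) * (L * K) := by
        rw [hmL]; simp only [mul_assoc]
    _ = (c * f1 * e1 * f1⁻¹ * c⁻¹ * e2 * c * e2⁻¹) * (K * L) := by rw [key, hKL.eq]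
    _ = c * f1 * e1 * f1⁻¹ * c⁻¹ * (e2 * c * e2⁻¹ * K) * L := by simp only [mul_assoc]
    _ = _ := by rw [← hmK]; simp only [mul_assoc]

/-- First commutation needed for `main_rel`. -/
lemma rel_E1 {a b c d S s : G} (hab : a * b * a = b * a * b) (hac : a * c * a = c * a * c)
    (hbc : Commute b c) (hda : Commute d a) (hdb : Commute d b) (hds : Commute d s)
    (hdS : Commute d S) (hSa : Commute S a) (hSc : Commute S c) (hsa : Commute s a) :
    Commute ((d * c * d⁻¹) * a * (d * c * d⁻¹)⁻¹) ((S * b * s) * a * (S * b * s)⁻¹) := by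
  have hd : Commute d ((S * b * s) * a * (S * b * s)⁻¹) :=
    ((((hdS.mul_right hdb).mul_right hds).mul_right hda).mul_right
      ((hdS.mul_right hdb).mul_right hds).inv_right)
  have e1 : (d * c * d⁻¹) * a * (d * c * d⁻¹)⁻¹ = d * (c * a * c⁻¹) * d⁻¹ := by
    calc (d * c * d⁻¹) * a * (d * c * d⁻¹)⁻¹ = d * c * (d⁻¹ * a) * d * c⁻¹ * d⁻¹ := by group
      _ = _ := by rw [hda.inv_left.eq]; group
  have e2 : c * a * c⁻¹ = a⁻¹ * c * a := by
    have : a * (c * a * c⁻¹) * c = a * (a⁻¹ * c * a) * c := by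
      calc a * (c * a * c⁻¹) * c = a * c * a := by group
        _ = c * a * c := hac
        _ = _ := by group
    exact mul_left_cancel (mul_right_cancel this)
  have e3 : b * a * b⁻¹ = a⁻¹ * b * a := by
    have : a * (b * a * b⁻¹) * b = a * (a⁻¹ * b * a) * b := by
      calc a * (b * a * b⁻¹) * b = a * b * a := by group
        _ = b * a * b := hab
        _ = _ := by group
    exact mul_left_cancel (mul_right_cancel this)
  have e4 : (S * b * s) * a * (S * b * s)⁻¹ = a⁻¹ * (S * b * S⁻¹) * a := by
    calc (S * b * s) * a * (S * b * s)⁻¹ = S * b * (s * a) * s⁻¹ * b⁻¹ * S⁻¹ := by group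
      _ = S * (b * a * b⁻¹) * S⁻¹ := by rw [hsa.eq]; group
      _ = (S * a⁻¹) * b * a * S⁻¹ := by rw [e3]; group
      _ = a⁻¹ * S * b * (a * S⁻¹) := by rw [hSa.inv_right.eq]; group
      _ = _ := by rw [hSa.inv_left.symm.eq]; group
  have h0 : Commute (c * a * c⁻¹) ((S * b * s) * a * (S * b * s)⁻¹) := by
    rw [e4, e2]
    have : Commute c (S * b * S⁻¹) :=
      (hSc.symm.mul_right hbc.symm).mul_right hSc.symm.inv_right
    have := (Commute.conj_iff a⁻¹).2 this
    simpa using this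
  rw [e1]
  exact (hd.mul_left h0).mul_left hd.inv_left

/-- Second commutation needed for `main_rel`. -/
lemma rel_E2 {a c d e M : G} (hac : a * c * a = c * a * c) (hcd : c * d * c = d * c * d)
    (hde : d * e * d = e * d * e) (had : Commute a d) (hae : Commute a e) (hce : Commute c e)
    (hMc : Commute M c) (hMd : Commute M d) :
    Commute (a * (d * c * d⁻¹) * a⁻¹)
      ((d * (d * (e * M))) * (d * c * d⁻¹) * (d * (d * (e * M)))⁻¹) := by
  have bc : ∀ {u v : G}, u * v * u = v * u * v → u * v * u⁻¹ = v⁻¹ * u * v := by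
    intro u v h
    have : v * (u * v * u⁻¹) * u = v * (v⁻¹ * u * v) * u := by
      calc v * (u * v * u⁻¹) * u = v * u * v := by group
        _ = u * v * u := h.symm
        _ = _ := by group
    exact mul_left_cancel (mul_right_cancel this)
  have e1 : a * (d * c * d⁻¹) * a⁻¹ = d * (c⁻¹ * a * c) * d⁻¹ := by
    rw [← bc hac]
    calc a * (d * c * d⁻¹) * a⁻¹ = (a * d) * c * (d⁻¹ * a⁻¹) := by group
      _ = _ := by rw [had.symm.inv_inv.eq, had.eq]; group
  have e2 : (d * (d * (e * M))) * (d * c * d⁻¹) * (d * (d * (e * M)))⁻¹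
      = d * (c⁻¹ * (d⁻¹ * e * d) * c) * d⁻¹ := by
    have hM : M * (d * c * d⁻¹) * M⁻¹ = d * c * d⁻¹ := by
      rw [((hMd.mul_right hMc).mul_right hMd.inv_right).eq]; group
    have hE : d * e * (c⁻¹ * d * c) * e⁻¹ * d⁻¹ = c⁻¹ * (d⁻¹ * e * d) * c := by
      calc d * e * (c⁻¹ * d * c) * e⁻¹ * d⁻¹ = d * (e * c⁻¹) * d * (c * e⁻¹) * d⁻¹ := by group
        _ = d * c⁻¹ * (e * d * e⁻¹) * c * d⁻¹ := by
            rw [hce.symm.inv_right.eq, hce.inv_right.eq]; group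
        _ = (d * c⁻¹ * d⁻¹) * e * (d * c * d⁻¹) := by rw [bc hde.symm]; group
        _ = (d * c * d⁻¹)⁻¹ * e * (d * c * d⁻¹) := by group
        _ = c⁻¹ * d⁻¹ * (c * e) * c⁻¹ * d * c := by rw [bc hcd.symm]; group
        _ = _ := by rw [hce.eq]; group
    calc (d * (d * (e * M))) * (d * c * d⁻¹) * (d * (d * (e * M)))⁻¹
        = d * (d * e * (M * (d * c * d⁻¹) * M⁻¹) * e⁻¹ * d⁻¹) * d⁻¹ := by group
      _ = d * (d * e * (c⁻¹ * d * c) * e⁻¹ * d⁻¹) * d⁻¹ := by rw [hM, bc hcd.symm]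
      _ = _ := by rw [hE]
  rw [e1, e2]
  have h : Commute a (d⁻¹ * e * d) := (had.inv_right.mul_right hae).mul_right had
  have h' := (Commute.conj_iff c⁻¹).2 h
  rw [inv_inv] at h'
  exact (Commute.conj_iff d).2 h'

end AbstractGroup

section Braid

lemma sig_pos (m j : ℕ) (h : 1 ≤ j ∧ j ≤ m - 1) :
    σ m j = (PresentedGroup.of (rels := braidRels m) ⟨j - 1, by omega⟩ : BraidGroup m) :=
  dif_pos h

lemma sig_neg (m j : ℕ) (h : ¬ (1 ≤ j ∧ j ≤ m - 1)) : σ m j = 1 := dif_neg h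

lemma pres_comm (m : ℕ) (i j : Fin (m - 1)) (h : (i : ℕ) + 2 ≤ (j : ℕ)) :
    (PresentedGroup.of (rels := braidRels m) i) * PresentedGroup.of j
      = PresentedGroup.of j * PresentedGroup.of i := by
  have hr : FreeGroup.of i * FreeGroup.of j * (FreeGroup.of j * FreeGroup.of i)⁻¹
      ∈ braidRels m := Or.inr ⟨i, j, h, rfl⟩
  have := PresentedGroup.one_of_mem hr
  rw [map_mul, map_inv, mul_inv_eq_one, map_mul, map_mul] at this
  exact this

lemma pres_braid (m : ℕ) (i j : Fin (m - 1)) (h : (i : ℕ) + 1 = (j : ℕ)) :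
    (PresentedGroup.of (rels := braidRels m) i) * PresentedGroup.of j * PresentedGroup.of i
      = PresentedGroup.of j * PresentedGroup.of i * PresentedGroup.of j := by
  have hr : FreeGroup.of i * FreeGroup.of j * FreeGroup.of i *
      (FreeGroup.of j * FreeGroup.of i * FreeGroup.of j)⁻¹
      ∈ braidRels m := Or.inl ⟨i, j, h, rfl⟩
  have := PresentedGroup.one_of_mem hr
  rw [map_mul, map_inv, mul_inv_eq_one, map_mul, map_mul, map_mul, map_mul] at this
  exact this

lemma sig_comm (m i j : ℕ) (h : i + 2 ≤ j) : Commute (σ m i) (σ m j) := by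
  by_cases h1 : 1 ≤ i ∧ i ≤ m - 1
  · by_cases h2 : 1 ≤ j ∧ j ≤ m - 1
    · rw [sig_pos m i h1, sig_pos m j h2]
      exact pres_comm m ⟨i - 1, by omega⟩ ⟨j - 1, by omega⟩ (by simp only; omega)
    · rw [sig_neg m j h2]
      exact Commute.one_right _
  · rw [sig_neg m i h1]
    exact Commute.one_left _

lemma sig_braid (m i : ℕ) (h : 1 ≤ i) (h' : i + 1 ≤ m - 1) :
    σ m i * σ m (i + 1) * σ m i = σ m (i + 1) * σ m i * σ m (i + 1) := by
  rw [sig_pos m i ⟨h, by omega⟩, sig_pos m (i + 1) ⟨by omega, h'⟩]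
  exact pres_braid m ⟨i - 1, by omega⟩ ⟨i + 1 - 1, by omega⟩ (by simp only; omega)

lemma sigI_cons (m i j : ℕ) (h : i ≤ j) : σI m i j = σ m i * σI m (i + 1) j := by
  unfold σI
  have : j + 1 - i = (j + 1 - (i + 1)) + 1 := by omega
  rw [this, List.range'_succ]
  simp

lemma sigI_snoc (m i j : ℕ) (h : i ≤ j + 1) : σI m i (j + 1) = σI m i j * σ m (j + 1) := by
  unfold σI
  have : j + 1 + 1 - i = (j + 1 - i) + 1 := by omega
  rw [this, List.range'_concat]
  have : i + 1 * (j + 1 - i) = j + 1 := by omega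
  rw [this]
  simp

lemma sigI_comm (m i j : ℕ) (z : BraidGroup m)
    (h : ∀ k, i ≤ k → k ≤ j → Commute (σ m k) z) : Commute (σI m i j) z := by
  unfold σI
  apply Commute.list_prod_left
  intro x hx
  obtain ⟨k, hk, rfl⟩ := List.mem_map.1 hx
  rw [List.mem_range'_1] at hk
  exact h k hk.1 (by omega)

end Braid

/-- For `p, q ≥ 1` and `n = p + q + 1`, the homomorphism
`φ : F(x,y) → B_{n+2}` with `φ(x) = σ_1 ⋯ σ_{p+1} σ_1` and `φ(y) = σ_{p+2} ⋯ σ_{n+1} σ_{p+2}`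
is not injective.  Here `F(x,y)` is the free group on two generators `x = FreeGroup.of true`
and `y = FreeGroup.of false`. -/
theorem monodromy_not_injective (p q : ℕ) (hp : 1 ≤ p) (hq : 1 ≤ q) (n : ℕ)
    (hn : n = p + q + 1) (φ : FreeGroup Bool →* BraidGroup (n + 2))
    (hx : φ (FreeGroup.of true) = σI (n + 2) 1 (p + 1) * σ (n + 2) 1)
    (hy : φ (FreeGroup.of false) = σI (n + 2) (p + 2) (n + 1) * σ (n + 2) (p + 2)) :
    ¬ Function.Injective φ := by
  generalize hm : n + 2 = m at φ hx hy
  intro hinj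
  -- the decomposition of `φ y`, valid for all `q`
  have hac : σ m (p + 1) * σ m (p + 2) * σ m (p + 1) = σ m (p + 2) * σ m (p + 1) * σ m (p + 2) :=
    sig_braid m (p + 1) (by omega) (by omega)
  have hcd : σ m (p + 2) * σ m (p + 3) * σ m (p + 2) = σ m (p + 3) * σ m (p + 2) * σ m (p + 3) :=
    sig_braid m (p + 2) (by omega) (by omega)
  have hMc : Commute (σI m (p + 4) (n + 1)) (σ m (p + 2)) :=
    sigI_comm _ _ _ _ fun k hk _ => (sig_comm m _ _ (by omega)).symm
  have hMlow : ∀ i, i ≤ p + 1 → Commute (σI m (p + 4) (n + 1)) (σ m i) := fun i hi =>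
    sigI_comm _ _ _ _ fun k hk _ => (sig_comm m _ _ (by omega)).symm
  have hy1 : φ (FreeGroup.of false)
      = σ m (p + 3) * σ m (p + 2) * (σ m (p + 3) * σI m (p + 4) (n + 1)) := by
    rw [hy, sigI_cons m (p + 2) (n + 1) (by omega), sigI_cons m (p + 2 + 1) (n + 1) (by omega)]
    calc σ m (p + 2) * (σ m (p + 3) * σI m (p + 4) (n + 1)) * σ m (p + 2)
        = σ m (p + 2) * σ m (p + 3) * (σI m (p + 4) (n + 1) * σ m (p + 2)) := by
          simp only [mul_assoc]
      _ = (σ m (p + 2) * σ m (p + 3) * σ m (p + 2)) * σI m (p + 4) (n + 1) := by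
          rw [hMc.eq]; simp only [mul_assoc]
      _ = _ := by rw [hcd]; simp only [mul_assoc]
  rcases Nat.lt_or_ge 1 p with hp2 | hp1
  · -- `p ≥ 2`
    have hSig : σI m 1 (p + 1) = σI m 1 (p - 1) * σ m p * σ m (p + 1) := by
      rw [sigI_snoc m 1 p (by omega)]
      obtain ⟨r, rfl⟩ : ∃ r, p = r + 1 := ⟨p - 1, by omega⟩
      rw [sigI_snoc m 1 r (by omega)]
      simp
    have h1a : Commute (σ m 1) (σ m (p + 1)) := sig_comm m _ _ (by omega)
    have hx1 : φ (FreeGroup.of true) = (σI m 1 (p - 1) * σ m p * σ m 1) * σ m (p + 1) := by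
      rw [hx, hSig]
      calc σI m 1 (p - 1) * σ m p * σ m (p + 1) * σ m 1
          = σI m 1 (p - 1) * σ m p * (σ m (p + 1) * σ m 1) := by simp only [mul_assoc]
        _ = _ := by rw [← h1a.eq]; simp only [mul_assoc]
    have hS : ∀ j, p + 1 ≤ j → Commute (σI m 1 (p - 1)) (σ m j) := fun j hj =>
      sigI_comm _ _ _ _ fun k hk hk' => sig_comm m _ _ (by omega)
    have hK : ∀ j, p + 2 ≤ j → Commute (σI m 1 (p - 1) * σ m p * σ m 1) (σ m j) := fun j hj =>
      ((hS j (by omega)).mul_left (sig_comm m _ _ (by omega))).mul_left (sig_comm m _ _ (by omega))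
    have hKM : Commute (σI m 1 (p - 1) * σ m p * σ m 1) (σI m (p + 4) (n + 1)) :=
      (sigI_comm _ _ _ _ fun k hk _ => (hK k (by omega)).symm).symm
    rcases Nat.lt_or_ge 1 q with hq2 | hq1
    · -- `q ≥ 2`
      have hy2 : φ (FreeGroup.of false) = (σ m (p + 3) * σ m (p + 2) * (σ m (p + 3))⁻¹) *
          (σ m (p + 3) * (σ m (p + 3) * (σ m (p + 4) * σI m (p + 5) (n + 1)))) := by
        rw [hy1, sigI_cons m (p + 4) (n + 1) (by omega)]
        group
      have had : Commute (σ m (p + 1)) (σ m (p + 3)) := sig_comm m _ _ (by omega)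
      have hKL : Commute (σI m 1 (p - 1) * σ m p * σ m 1)
          (σ m (p + 3) * (σ m (p + 3) * (σ m (p + 4) * σI m (p + 5) (n + 1)))) := by
        rw [← sigI_cons m (p + 4) (n + 1) (by omega)]
        exact (hK _ (by omega)).mul_right ((hK _ (by omega)).mul_right hKM)
      have hKc : Commute (σI m 1 (p - 1) * σ m p * σ m 1)
          (σ m (p + 3) * σ m (p + 2) * (σ m (p + 3))⁻¹) :=
        ((hK _ (by omega)).mul_right (hK _ (by omega))).mul_right (hK _ (by omega)).inv_right
      have hLa : Commute (σ m (p + 3) * (σ m (p + 3) * (σ m (p + 4) * σI m (p + 5) (n + 1))))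
          (σ m (p + 1)) := by
        rw [← sigI_cons m (p + 4) (n + 1) (by omega)]
        exact had.symm.mul_left (had.symm.mul_left (hMlow _ le_rfl))
      have hac' : σ m (p + 1) * (σ m (p + 3) * σ m (p + 2) * (σ m (p + 3))⁻¹) * σ m (p + 1)
          = (σ m (p + 3) * σ m (p + 2) * (σ m (p + 3))⁻¹) * σ m (p + 1) *
            (σ m (p + 3) * σ m (p + 2) * (σ m (p + 3))⁻¹) := by
        have e : σ m (p + 1) = σ m (p + 3) * σ m (p + 1) * (σ m (p + 3))⁻¹ := by
          rw [← had.eq]; group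
        calc σ m (p + 1) * (σ m (p + 3) * σ m (p + 2) * (σ m (p + 3))⁻¹) * σ m (p + 1)
            = (σ m (p + 3) * σ m (p + 1) * (σ m (p + 3))⁻¹) *
              (σ m (p + 3) * σ m (p + 2) * (σ m (p + 3))⁻¹) *
              (σ m (p + 3) * σ m (p + 1) * (σ m (p + 3))⁻¹) := by rw [← e]
          _ = σ m (p + 3) * (σ m (p + 1) * σ m (p + 2) * σ m (p + 1)) * (σ m (p + 3))⁻¹ := by group
          _ = (σ m (p + 3) * σ m (p + 2) * (σ m (p + 3))⁻¹) *
              (σ m (p + 3) * σ m (p + 1) * (σ m (p + 3))⁻¹) *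
              (σ m (p + 3) * σ m (p + 2) * (σ m (p + 3))⁻¹) := by rw [hac]; group
          _ = _ := by rw [← e]
      have hab : σ m (p + 1) * σ m p * σ m (p + 1) = σ m p * σ m (p + 1) * σ m p :=
        (sig_braid m p (by omega) (by omega)).symm
      have hde : σ m (p + 3) * σ m (p + 4) * σ m (p + 3)
          = σ m (p + 4) * σ m (p + 3) * σ m (p + 4) := sig_braid m (p + 3) (by omega) (by omega)
      have hM2 : ∀ j, j ≤ p + 3 → Commute (σI m (p + 5) (n + 1)) (σ m j) := fun j hj =>
        sigI_comm _ _ _ _ fun k hk _ => (sig_comm m _ _ (by omega)).symm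
      have rel := main_rel hac' hKL hKc hLa
        (rel_E1 hab hac (sig_comm m _ _ (by omega)) had.symm (sig_comm m _ _ (by omega)).symm
          (sig_comm m _ _ (by omega)).symm (hS _ (by omega)).symm (hS _ (by omega))
          (hS _ (by omega)) h1a)
        (rel_E2 hac hcd hde had (sig_comm m _ _ (by omega)) (sig_comm m _ _ (by omega))
          (hM2 _ (by omega)) (hM2 _ (by omega)))
      rw [← hx1, ← hy2] at rel
      simp only [← map_mul, ← map_inv, ← map_pow] at rel
      have := hinj rel
      revert this
      decide
    · -- `q = 1`
      have hq' : q = 1 := by omega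
      have hM1 : σI m (p + 4) (n + 1) = 1 := by
        unfold σI
        have : n + 1 + 1 - (p + 4) = 0 := by omega
        rw [this]; simp
      have hy2 : φ (FreeGroup.of false) = σ m (p + 2) * σ m (p + 3) * σ m (p + 2) := by
        rw [hy1, hM1, hcd]; simp only [mul_assoc, mul_one]
      have hQ := comm_Q (a := σ m (p + 2)) (b := σ m (p + 3)) (c := σ m (p + 1)) hcd hac.symm
        (sig_comm m _ _ (by omega)).symm.eq
      rw [← hy2] at hQ
      set K := σI m 1 (p - 1) * σ m p * σ m 1 with hKdef
      set a := σ m (p + 1) with ha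
      set y := φ (FreeGroup.of false) with hydef
      have hKy : Commute K y := by
        rw [hy2]
        exact ((hK _ (by omega)).mul_right (hK _ (by omega))).mul_right (hK _ (by omega))
      have hw : (K * a) * y * (K * a)⁻¹ * y * (K * a) = K * (a * y * a⁻¹ * y * a) := by
        calc (K * a) * y * (K * a)⁻¹ * y * (K * a)
            = K * a * y * a⁻¹ * K⁻¹ * (y * K) * a := by group
          _ = _ := by rw [← hKy.eq]; group
      have rel : Commute (y * y) ((K * a) * y * (K * a)⁻¹ * y * (K * a)) := by
        rw [hw]
        exact (hKy.symm.mul_left hKy.symm).mul_right hQ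
      have rel := rel.eq
      rw [← hx1, hydef] at rel
      simp only [← map_mul, ← map_inv] at rel
      have := hinj rel
      revert this
      decide
  · -- `p = 1`
    obtain rfl : p = 1 := by omega
    have hx1 : φ (FreeGroup.of true) = σ m 2 * σ m 1 * σ m 2 := by
      rw [hx, sigI_cons m 1 (1 + 1) (by omega), sigI_cons m (1 + 1) (1 + 1) (by omega)]
      have : σI m (1 + 1 + 1) (1 + 1) = 1 := by
        unfold σI; simp
      rw [this, mul_one]
      exact sig_braid m 1 (by omega) (by omega)
    have hQ := comm_Q (a := σ m 2) (b := σ m 1) (c := σ m 3)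
      (sig_braid m 1 (by omega) (by omega)).symm hac (sig_comm m _ _ (by omega)).eq
    rw [← hx1] at hQ
    have hdx : Commute (σ m 4) (φ (FreeGroup.of true)) := by
      rw [hx1]
      exact ((sig_comm m 2 4 (by omega)).symm.mul_right (sig_comm m 1 4 (by omega)).symm).mul_right
        (sig_comm m 2 4 (by omega)).symm
    have hMx : Commute (σI m 5 (n + 1)) (φ (FreeGroup.of true)) := by
      rw [hx1]
      exact ((hMlow 2 (by omega)).mul_right (hMlow 1 (by omega))).mul_right (hMlow 2 (by omega))
    have hNx : Commute (σ m 4 * σI m 5 (n + 1)) (φ (FreeGroup.of true)) := hdx.mul_left hMx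
    have hy2 : φ (FreeGroup.of false) = σ m 4 * σ m 3 * (σ m 4 * σI m 5 (n + 1)) := hy1
    set x := φ (FreeGroup.of true) with hxdef
    set N := σ m 4 * σI m 5 (n + 1) with hN
    set d := σ m 4 with hd
    set c := σ m 3 with hc
    have hw : (d * c * N) * x * (d * c * N)⁻¹ * x * (d * c * N)
        = d * (c * x * c⁻¹ * x * c) * N := by
      calc (d * c * N) * x * (d * c * N)⁻¹ * x * (d * c * N)
          = d * c * (N * x) * N⁻¹ * c⁻¹ * d⁻¹ * (x * d) * c * N := by group
        _ = _ := by rw [hNx.eq, ← hdx.eq]; group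
    have rel : Commute (x * x) ((d * c * N) * x * (d * c * N)⁻¹ * x * (d * c * N)) := by
      rw [hw]
      exact ((hdx.symm.mul_left hdx.symm).mul_right hQ).mul_right (hNx.symm.mul_left hNx.symm)
    have rel := rel.eq
    rw [← hy2, hxdef] at rel
    simp only [← map_mul, ← map_inv] at rel
    have := hinj rel
    revert this
    decide
end

section
/- For every integer p ≥ 1, the element [x^{p+1}, y x^p y^{-1} x y] = x^{p+1} (y x^p y^{-1} x y) x^{-(p+1)} (y x^p y^{-1} x y)^{-1} is a non-trivial element of the free group F(x, y). -/
/-- The upper unipotent matrix. -/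
def upperUni (n : ℤ) : Matrix.SpecialLinearGroup (Fin 2) ℤ :=
  ⟨!![1, n; 0, 1], by simp [Matrix.det_fin_two]⟩

/-- The lower unipotent matrix. -/
def lowerUni (n : ℤ) : Matrix.SpecialLinearGroup (Fin 2) ℤ :=
  ⟨!![1, 0; n, 1], by simp [Matrix.det_fin_two]⟩

theorem upperUni_val (n : ℤ) : (upperUni n).1 = !![1, n; 0, 1] := rfl

theorem lowerUni_val (n : ℤ) : (lowerUni n).1 = !![1, 0; n, 1] := rfl

theorem upperUni_pow (n : ℕ) : upperUni 1 ^ n = upperUni n := by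
  induction n with
  | zero =>
    ext i j
    fin_cases i <;> fin_cases j <;> simp [upperUni_val]
  | succ k ih =>
    rw [pow_succ, ih]
    ext i j
    fin_cases i <;> fin_cases j <;>
      simp [upperUni_val, Matrix.mul_apply, Fin.sum_univ_two, add_comm]

theorem lowerUni_inv : (lowerUni 2)⁻¹ = lowerUni (-2) := by
  rw [inv_eq_iff_mul_eq_one]
  ext i j
  fin_cases i <;> fin_cases j <;>
    simp [lowerUni_val, Matrix.mul_apply, Fin.sum_univ_two]

/-- For every `p ≥ 1`, the commutator
`[x^{p+1}, y x^p y⁻¹ x y] = x^{p+1} (y x^p y⁻¹ x y) x^{-(p+1)} (y x^p y⁻¹ x y)⁻¹`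
is a non-trivial element of the free group `F(x, y)`, where `x = FreeGroup.of true` and
`y = FreeGroup.of false`. -/
theorem magic_word_nontrivial (p : ℕ) (hp : 1 ≤ p)
    (x y : FreeGroup Bool) (hx : x = FreeGroup.of true) (hy : y = FreeGroup.of false) :
    x ^ (p + 1) * (y * x ^ p * y⁻¹ * x * y) * (x ^ (p + 1))⁻¹ *
      (y * x ^ p * y⁻¹ * x * y)⁻¹ ≠ 1 := by
  intro h
  rw [mul_inv_eq_one, mul_inv_eq_iff_eq_mul] at h
  have h2 := congrArg
    (FreeGroup.lift (fun b : Bool => if b then upperUni 1 else lowerUni 2)) h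
  subst hx hy
  simp only [map_mul, map_pow, map_inv, FreeGroup.lift_apply_of, if_true, Bool.false_eq_true,
    if_false, upperUni_pow, lowerUni_inv] at h2
  have h3 := congrArg (fun M : Matrix.SpecialLinearGroup (Fin 2) ℤ => M.1 0 0) h2
  simp [upperUni_val, lowerUni_val, Matrix.mul_apply, Fin.sum_univ_two] at h3
  have hp' : (1 : ℤ) ≤ p := by exact_mod_cast hp
  omega
end

section
/- Let m ≥ 3 and let 2 ≤ k ≤ m - 1. Then in the braid group B_m the identity twist_{k+1} = twist_k · push_{k+1} holds. -/
namespace BraidAux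

/-- ascending product `s (a+1) ⋯ s (a+n)` -/
def asc {G : Type*} [Group G] (s : ℕ → G) (a : ℕ) : ℕ → G
  | 0 => 1
  | n + 1 => asc s a n * s (a + n + 1)

/-- descending product `s (a+n) ⋯ s (a+1)` -/
def desc {G : Type*} [Group G] (s : ℕ → G) (a : ℕ) : ℕ → G
  | 0 => 1
  | n + 1 => s (a + n + 1) * desc s a n

variable {G : Type*} [Group G] (s : ℕ → G) (N : ℕ)

theorem asc_comm (hc : ∀ i j, i + 2 ≤ j → s i * s j = s j * s i) (j n : ℕ) (h : n + 2 ≤ j) :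
    asc s 0 n * s j = s j * asc s 0 n := by
  induction n with
  | zero => simp [asc]
  | succ n ih =>
    simp only [asc]
    rw [mul_assoc, hc _ j (by omega), ← mul_assoc, ih (by omega), mul_assoc]

theorem shift (hc : ∀ i j, i + 2 ≤ j → s i * s j = s j * s i)
    (hb : ∀ i, 1 ≤ i → i + 1 ≤ N → s i * s (i + 1) * s i = s (i + 1) * s i * s (i + 1))
    (i n : ℕ) (hi : 1 ≤ i) (hin : i + 1 ≤ n) (hn : n ≤ N) :
    asc s 0 n * s i = s (i + 1) * asc s 0 n := by
  induction n, hin using Nat.le_induction with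
  | base =>
    obtain ⟨i, rfl⟩ : ∃ j, i = j + 1 := ⟨i - 1, by omega⟩
    simp only [asc, zero_add]
    have h1 := hb (i + 1) hi hn
    have h2 := asc_comm s hc (i + 1 + 1) i (by omega)
    calc asc s 0 i * s (i + 1) * s (i + 1 + 1) * s (i + 1)
        = asc s 0 i * (s (i + 1) * s (i + 1 + 1) * s (i + 1)) := by simp only [mul_assoc]
      _ = (asc s 0 i * s (i + 1 + 1)) * (s (i + 1) * s (i + 1 + 1)) := by
        rw [h1]; simp only [mul_assoc]
      _ = _ := by rw [h2]; simp only [mul_assoc]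
  | succ n hin ih =>
    simp only [asc, zero_add]
    rw [mul_assoc, ← hc i (n + 1) (by omega), ← mul_assoc, ih (by omega), mul_assoc]

theorem pow_shift (x : G) (k : ℕ) (hx : ∀ i, 1 ≤ i → i + 1 ≤ k → x * s i = s (i + 1) * x)
    (j : ℕ) (hj : j + 1 ≤ k) : x ^ j * s 1 = s (j + 1) * x ^ j := by
  induction j with
  | zero => simp
  | succ j ih =>
    rw [pow_succ', mul_assoc, ih (by omega), ← mul_assoc, hx _ (by omega) hj, mul_assoc]

theorem twist_pow (x : G) (k : ℕ) (hx : ∀ i, 1 ≤ i → i + 1 ≤ k → x * s i = s (i + 1) * x)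
    (j : ℕ) (hj : j + 1 ≤ k) : (x * s 1) ^ j = asc s 1 j * x ^ j := by
  induction j with
  | zero => simp [asc]
  | succ j ih =>
    rw [pow_succ, ih (by omega), mul_assoc, ← mul_assoc (x ^ j), ← pow_succ,
      pow_shift s x k hx (j + 1) hj, ← mul_assoc]
    simp only [asc]
    rw [show 1 + j + 1 = j + 1 + 1 by omega]

theorem asc_head (n : ℕ) : s 1 * asc s 1 n = asc s 0 (n + 1) := by
  induction n with
  | zero => simp [asc]
  | succ n ih =>
    rw [asc, ← mul_assoc, ih, asc.eq_def s 0 (n + 1 + 1)]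
    simp only
    rw [show 1 + n + 1 = 0 + (n + 1) + 1 by omega]

theorem twist_eq (k : ℕ)
    (hx : ∀ i, 1 ≤ i → i + 1 ≤ k + 1 → asc s 0 (k + 1) * s i = s (i + 1) * asc s 0 (k + 1)) :
    (asc s 0 (k + 1) * s 1) ^ (k + 1) = asc s 0 (k + 1) ^ (k + 2) := by
  rw [pow_succ', twist_pow s _ (k + 1) hx k le_rfl, mul_assoc, ← mul_assoc (s 1), asc_head,
    ← pow_succ', ← pow_succ']

theorem desc_shift (x : G) (k : ℕ) (hx : ∀ i, 1 ≤ i → i + 1 ≤ k → x * s i = s (i + 1) * x)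
    (a n : ℕ) (h : a + 1 + n ≤ k) : desc s (a + 1) n * x = x * desc s a n := by
  induction n with
  | zero => simp [desc]
  | succ n ih =>
    simp only [desc]
    rw [mul_assoc, ih (by omega), ← mul_assoc, ← mul_assoc, hx (a + n + 1) (by omega) (by omega),
      show a + 1 + n + 1 = a + n + 1 + 1 by omega]

theorem pow_eq (k : ℕ)
    (hx : ∀ i, 1 ≤ i → i + 1 ≤ k + 1 → asc s 0 (k + 1) * s i = s (i + 1) * asc s 0 (k + 1))
    (j a : ℕ) (h : a + j = k + 1) :
    asc s 0 (k + 1) ^ j = asc s 0 k ^ j * desc s a j := by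
  induction j generalizing a with
  | zero => simp [desc]
  | succ j ih =>
    rw [pow_succ, ih (a + 1) (by omega), mul_assoc, desc_shift s _ (k + 1) hx a j (by omega)]
    simp only [asc, desc]
    rw [pow_succ, show a + j + 1 = 0 + k + 1 by omega]
    simp only [mul_assoc]

theorem main (hc : ∀ i j, i + 2 ≤ j → s i * s j = s j * s i)
    (hb : ∀ i, 1 ≤ i → i + 1 ≤ N → s i * s (i + 1) * s i = s (i + 1) * s i * s (i + 1))
    (k : ℕ) (hk : k + 2 ≤ N) :
    (asc s 0 (k + 2) * s 1) ^ (k + 2) =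
      (asc s 0 (k + 1) * s 1) ^ (k + 1) * (desc s 0 (k + 2) * asc s 0 (k + 2)) := by
  have h1 := fun i hi hik => shift s N hc hb i (k + 1) hi hik (by omega)
  have h2 := fun i hi hik => shift s N hc hb i (k + 2) hi hik hk
  rw [twist_eq s k h1, twist_eq s (k + 1) h2, pow_succ, pow_eq s (k + 1) h2 (k + 2) 0 (by omega),
    mul_assoc]

/-- the canonical map from the free group, as a map to the braid group -/
def toB (m : ℕ) : FreeGroup (Fin (m - 1)) →* BraidGroup m := PresentedGroup.mk (braidRels m)

theorem toB_rel (m : ℕ) (x y : FreeGroup (Fin (m - 1))) (h : x * y⁻¹ ∈ braidRels m) :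
    toB m x = toB m y := by
  have h1 : toB m (x * y⁻¹) = 1 := PresentedGroup.one_of_mem h
  rw [map_mul, map_inv] at h1
  exact mul_inv_eq_one.mp h1

theorem σ_eq (m j : ℕ) (h : 1 ≤ j ∧ j ≤ m - 1) :
    σ m j = toB m (FreeGroup.of ⟨j - 1, by omega⟩) := dif_pos h

theorem σ_one (m j : ℕ) (h : ¬ (1 ≤ j ∧ j ≤ m - 1)) : σ m j = 1 := dif_neg h

theorem σ_comm (m i j : ℕ) (h : i + 2 ≤ j) : σ m i * σ m j = σ m j * σ m i := by
  by_cases h1 : 1 ≤ i ∧ i ≤ m - 1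
  · by_cases h2 : 1 ≤ j ∧ j ≤ m - 1
    · rw [σ_eq m i h1, σ_eq m j h2, ← map_mul, ← map_mul]
      exact toB_rel m _ _ (Or.inr ⟨_, _, (by show i - 1 + 2 ≤ j - 1; omega), rfl⟩)
    · rw [σ_one m j h2, mul_one, one_mul]
  · rw [σ_one m i h1, mul_one, one_mul]

theorem σ_braid (m i : ℕ) (h : 1 ≤ i) (h' : i + 1 ≤ m - 1) :
    σ m i * σ m (i + 1) * σ m i = σ m (i + 1) * σ m i * σ m (i + 1) := by
  rw [σ_eq m i ⟨h, by omega⟩, σ_eq m (i + 1) ⟨by omega, h'⟩]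
  simp only [← map_mul]
  exact toB_rel m _ _ (Or.inl ⟨_, _, (by show i - 1 + 1 = i + 1 - 1; omega), rfl⟩)

theorem σI_eq (m n : ℕ) : σI m 1 n = asc (σ m) 0 n := by
  induction n with
  | zero => simp [σI, asc]
  | succ n ih =>
    simp only [asc, ← ih, σI, Nat.add_sub_cancel]
    rw [List.range'_1_concat]
    simp [add_comm]

theorem σIrev_eq (m n : ℕ) : σIrev m 1 n = desc (σ m) 0 n := by
  induction n with
  | zero => simp [σIrev, desc]
  | succ n ih =>
    simp only [desc, ← ih, σIrev, Nat.add_sub_cancel]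
    rw [List.range'_1_concat]
    simp [add_comm]

end BraidAux

/-- For `m ≥ 3` and `2 ≤ k ≤ m - 1`, in `B_m` we have
`twist_{k+1} = twist_k · push_{k+1}`. -/
theorem twist_succ_eq_twist_mul_push (m k : ℕ) (hm : 3 ≤ m) (hk : 2 ≤ k)
    (hkm : k ≤ m - 1) :
    twist m (k + 1) = twist m k * push m (k + 1) := by
  obtain ⟨k, rfl⟩ : ∃ j, k = j + 2 := ⟨k - 2, by omega⟩
  simp only [twist, push, BraidAux.σI_eq, BraidAux.σIrev_eq]
  exact BraidAux.main (σ m) (m - 1) (BraidAux.σ_comm m) (BraidAux.σ_braid m) k hkm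
end

section
/- Let m ≥ 2 and 2 ≤ k ≤ m. Then in the braid group B_m the element twist_k commutes with σ_i for every 1 ≤ i ≤ m - 1 with i ≠ k. -/
namespace TwistAux

variable {G : Type*} [Group G]

/-- The product `s a * s (a+1) * ⋯` of `l` consecutive terms. -/
def P (s : ℕ → G) (a l : ℕ) : G := ((List.range' a l).map s).prod

theorem P_zero (s : ℕ → G) (a : ℕ) : P s a 0 = 1 := by simp [P]

theorem P_add (s : ℕ → G) (a l l' : ℕ) : P s a (l + l') = P s a l * P s (a + l) l' := by
  simp only [P]
  rw [← List.prod_append, ← List.map_append]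
  congr 2
  have := @List.range'_append a l l' 1
  rw [one_mul] at this
  exact this.symm

theorem P_one (s : ℕ → G) (a : ℕ) : P s a 1 = s a := by simp [P]

theorem P_succ (s : ℕ → G) (a l : ℕ) : P s a (l + 1) = P s a l * s (a + l) := by
  rw [P_add, P_one]

theorem P_succ' (s : ℕ → G) (a l : ℕ) : P s a (l + 1) = s a * P s (a + 1) l := by
  rw [add_comm, P_add, P_one]

theorem P_comm (s : ℕ → G) (g : G) (a l : ℕ)
    (h : ∀ i, a ≤ i → i < a + l → Commute g (s i)) : Commute g (P s a l) := by
  induction l with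
  | zero => rw [P_zero]; exact Commute.one_right g
  | succ l ih =>
    rw [P_succ]
    exact (ih fun i h1 h2 => h i h1 (by omega)).mul_right (h _ (by omega) (by omega))

theorem shift (s : ℕ → G) (N : ℕ)
  (hb : ∀ i, 1 ≤ i → i + 1 ≤ N → s i * s (i + 1) * s i = s (i + 1) * s i * s (i + 1))
  (hc : ∀ i j, 1 ≤ i → i + 2 ≤ j → j ≤ N → Commute (s i) (s j))
    (i : ℕ) (h1 : 1 ≤ i) (h2 : i + 1 ≤ N) : P s 1 N * s i = s (i + 1) * P s 1 N := by
  obtain ⟨a, rfl⟩ : ∃ a, i = 1 + a := ⟨i - 1, by omega⟩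
  obtain ⟨b, rfl⟩ : ∃ b, N = a + (1 + (1 + b)) := ⟨N - a - 2, by omega⟩
  rw [P_add, P_add s (1 + a), P_add s (1 + a + 1), P_one, P_one]
  have c1 : Commute (s (1 + a)) (P s (1 + a + 1 + 1) b) :=
    P_comm _ _ _ _ fun j _ _ => hc _ _ (by omega) (by omega) (by omega)
  have c2 : Commute (s (1 + a + 1)) (P s 1 a) :=
    P_comm _ _ _ _ fun j _ _ => (hc _ _ (by omega) (by omega) (by omega)).symm
  have h := hb (1 + a) (by omega) (by omega)
  calc _ = P s 1 a * (s (1 + a) * (s (1 + a + 1) * (P s (1 + a + 1 + 1) b * s (1 + a)))) := by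
        simp only [mul_assoc]
    _ = P s 1 a * (s (1 + a) * s (1 + a + 1) * s (1 + a)) * P s (1 + a + 1 + 1) b := by
        rw [← c1.eq]; simp only [mul_assoc]
    _ = (P s 1 a * s (1 + a + 1)) * (s (1 + a) * s (1 + a + 1)) * P s (1 + a + 1 + 1) b := by
        rw [h]; simp only [mul_assoc]
    _ = _ := by rw [← c2.eq]; simp only [mul_assoc]

theorem shiftP (s : ℕ → G) (N : ℕ)
  (hb : ∀ i, 1 ≤ i → i + 1 ≤ N → s i * s (i + 1) * s i = s (i + 1) * s i * s (i + 1))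
  (hc : ∀ i j, 1 ≤ i → i + 2 ≤ j → j ≤ N → Commute (s i) (s j))
    (a l : ℕ) (h1 : 1 ≤ a) (h2 : a + l ≤ N) :
    P s 1 N * P s a l = P s (a + 1) l * P s 1 N := by
  induction l with
  | zero => simp [P_zero]
  | succ l ih =>
    rw [P_succ, P_succ, ← mul_assoc, ih (by omega), mul_assoc,
      shift s N hb hc _ (by omega) (by omega), ← mul_assoc, add_right_comm]

theorem shift_pow (s : ℕ → G) (N : ℕ)
  (hb : ∀ i, 1 ≤ i → i + 1 ≤ N → s i * s (i + 1) * s i = s (i + 1) * s i * s (i + 1))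
  (hc : ∀ i j, 1 ≤ i → i + 2 ≤ j → j ≤ N → Commute (s i) (s j))
    (j : ℕ) (i : ℕ) (h1 : 1 ≤ i) (h : i + j ≤ N) :
    P s 1 N ^ j * s i = s (i + j) * P s 1 N ^ j := by
  induction j with
  | zero => simp
  | succ j ih =>
    rw [pow_succ', mul_assoc, ih (by omega), ← mul_assoc,
      shift s N hb hc _ (by omega) (by omega), mul_assoc, add_assoc]

theorem eps_pow (s : ℕ → G) (N : ℕ)
  (hb : ∀ i, 1 ≤ i → i + 1 ≤ N → s i * s (i + 1) * s i = s (i + 1) * s i * s (i + 1))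
  (hc : ∀ i j, 1 ≤ i → i + 2 ≤ j → j ≤ N → Commute (s i) (s j))
    (j : ℕ) (h : j + 1 ≤ N) :
    (P s 1 N * s 1) ^ j = P s 2 j * P s 1 N ^ j := by
  induction j with
  | zero => simp [P_zero]
  | succ j ih =>
    have e := shift_pow s N hb hc (j + 1) 1 le_rfl (by omega)
    rw [pow_succ, ih (by omega), P_succ, mul_assoc, ← mul_assoc (_ ^ j), ← pow_succ, e,
      mul_assoc, show 1 + (j + 1) = 2 + j by omega]

theorem eps_full (s : ℕ → G) (N : ℕ)
  (hb : ∀ i, 1 ≤ i → i + 1 ≤ N → s i * s (i + 1) * s i = s (i + 1) * s i * s (i + 1))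
  (hc : ∀ i j, 1 ≤ i → i + 2 ≤ j → j ≤ N → Commute (s i) (s j))
    (hN : 1 ≤ N) : (P s 1 N * s 1) ^ N = P s 1 N ^ (N + 1) := by
  obtain ⟨n, rfl⟩ : ∃ n, N = n + 1 := ⟨N - 1, by omega⟩
  rw [pow_succ', eps_pow s _ hb hc n le_rfl, mul_assoc, ← mul_assoc (s 1),
    ← P_succ' s 1 n, ← pow_succ', ← pow_succ']

theorem comm_one (s : ℕ → G) (N : ℕ)
  (hb : ∀ i, 1 ≤ i → i + 1 ≤ N → s i * s (i + 1) * s i = s (i + 1) * s i * s (i + 1))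
  (hc : ∀ i j, 1 ≤ i → i + 2 ≤ j → j ≤ N → Commute (s i) (s j))
    (hN : 1 ≤ N) : Commute (P s 1 N ^ (N + 1)) (s 1) := by
  obtain ⟨n, rfl⟩ : ∃ n, N = n + 1 := ⟨N - 1, by omega⟩
  have e := shift_pow s _ hb hc n 1 le_rfl (by omega)
  have f := shiftP s _ hb hc 1 n le_rfl (by omega)
  have key : P s 1 (n + 1) ^ 2 * s (1 + n) = s 1 * P s 1 (n + 1) ^ 2 := by
    have h2 : P s 1 (n + 1) ^ 2 = P s 2 n * P s 1 (n + 1) * s (1 + n) := by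
      rw [← f, mul_assoc, ← P_succ, sq]
    conv_rhs => rw [h2, ← mul_assoc, ← mul_assoc, ← P_succ']
    rw [sq]
  show _ * _ = _ * _
  rw [show n + 1 + 1 = 2 + n by omega, pow_add, mul_assoc, e, ← mul_assoc, key, mul_assoc]

theorem comm_all (s : ℕ → G) (N : ℕ)
  (hb : ∀ i, 1 ≤ i → i + 1 ≤ N → s i * s (i + 1) * s i = s (i + 1) * s i * s (i + 1))
  (hc : ∀ i j, 1 ≤ i → i + 2 ≤ j → j ≤ N → Commute (s i) (s j))
    (i : ℕ) (h1 : 1 ≤ i) (h : i ≤ N) : Commute (P s 1 N ^ (N + 1)) (s i) := by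
  obtain ⟨j, rfl⟩ : ∃ j, i = 1 + j := ⟨i - 1, by omega⟩
  have e := shift_pow s N hb hc j 1 le_rfl h
  rw [← eq_mul_inv_iff_mul_eq.mpr e.symm |>.symm]
  have c : Commute (P s 1 N ^ (N + 1)) (P s 1 N ^ j) := Commute.pow_pow_self _ _ _
  exact (c.mul_right (comm_one s N hb hc (by omega))).mul_right c.inv_right

/-- The generators, typed in `BraidGroup m`. -/
def gen (m : ℕ) (i : Fin (m - 1)) : BraidGroup m :=
  (PresentedGroup.of i : PresentedGroup (braidRels m))

theorem σ_eq (m i : ℕ) (h : 1 ≤ i ∧ i ≤ m - 1) : σ m i = gen m ⟨i - 1, by omega⟩ :=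
  dif_pos h

theorem σ_braid (m i : ℕ) (h1 : 1 ≤ i) (h2 : i + 1 ≤ m - 1) :
    σ m i * σ m (i + 1) * σ m i = σ m (i + 1) * σ m i * σ m (i + 1) := by
  rw [σ_eq m _ ⟨h1, by omega⟩, σ_eq m _ ⟨by omega, h2⟩]
  rw [← mul_inv_eq_one]
  exact PresentedGroup.one_of_mem (rels := braidRels m)
    (Or.inl ⟨⟨i - 1, by omega⟩, ⟨i + 1 - 1, by omega⟩, by simp; omega, rfl⟩)

theorem σ_comm (m i j : ℕ) (h1 : 1 ≤ i) (h2 : i + 2 ≤ j) (h3 : j ≤ m - 1) :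
    Commute (σ m i) (σ m j) := by
  show _ * _ = _ * _
  rw [σ_eq m _ ⟨h1, by omega⟩, σ_eq m _ ⟨by omega, h3⟩]
  rw [← mul_inv_eq_one]
  exact PresentedGroup.one_of_mem (rels := braidRels m)
    (Or.inr ⟨⟨i - 1, by omega⟩, ⟨j - 1, by omega⟩, by simp; omega, rfl⟩)

end TwistAux

/-- For `m ≥ 2` and `2 ≤ k ≤ m`, in `B_m` the element `twist_k` commutes
with `σ_i` for every `1 ≤ i ≤ m - 1` with `i ≠ k`. -/
theorem twist_commutes_with_sigma (m k : ℕ) (hm : 2 ≤ m) (hk : 2 ≤ k) (hkm : k ≤ m) :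
    ∀ i : ℕ, 1 ≤ i → i ≤ m - 1 → i ≠ k → Commute (twist m k) (σ m i) := by
  intro i h1 h2 hik
  have hP : σI m 1 (k - 1) = TwistAux.P (σ m) 1 (k - 1) := by
    simp [σI, TwistAux.P]
  rw [twist, hP]
  rcases lt_or_gt_of_ne hik with h | h
  · rw [TwistAux.eps_full (σ m) (k - 1)
      (fun j a b => TwistAux.σ_braid m j a (by omega))
      (fun j l a b c => TwistAux.σ_comm m j l a b (by omega)) (by omega)]
    exact TwistAux.comm_all (σ m) (k - 1)
      (fun j a b => TwistAux.σ_braid m j a (by omega))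
      (fun j l a b c => TwistAux.σ_comm m j l a b (by omega)) i h1 (by omega)
  · refine Commute.pow_left (Commute.mul_left ?_ ?_) _
    · exact (TwistAux.P_comm _ _ _ _ fun j _ _ =>
        (TwistAux.σ_comm m j i (by omega) (by omega) h2).symm).symm
    · exact TwistAux.σ_comm m 1 i le_rfl (by omega) h2
end

section
/- Fix integers p, q ≥ 1 and set n = p + q + 1. Let a, b ∈ ℂ and let f be a polynomial over ℂ whose derivative is f'(X) = n (X - a)^p (X - a - b)^q. Then f(a + b) - f(a) = μ b^n, where μ is the (real, viewed as complex) constant μ = n ∫₀¹ t^p (t - 1)^q dt. -/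
open Polynomial

/-- For `p, q ≥ 1`, `n = p + q + 1`, `a b : ℂ`, and `f ∈ ℂ[X]` with
`f' = n (X - a)^p (X - (a + b))^q`, we have `f(a + b) - f(a) = μ b^n`, where
`μ = n ∫₀¹ t^p (t-1)^q dt` (a real number viewed as complex). -/
theorem critical_value_difference (p q : ℕ) (hp : 1 ≤ p) (hq : 1 ≤ q) (n : ℕ)
    (hn : n = p + q + 1) (a b : ℂ) (f : Polynomial ℂ)
    (hf : f.derivative = C (n : ℂ) * (X - C a) ^ p * (X - C (a + b)) ^ q) :
    f.eval (a + b) - f.eval a =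
      (n : ℂ) * ((∫ t in (0:ℝ)..1, t ^ p * (t - 1) ^ q : ℝ) : ℂ) * b ^ n := by
  have hd : ∀ t : ℝ, HasDerivAt (fun t : ℝ => f.eval (a + (t : ℂ) * b))
      ((n : ℂ) * b ^ n * ((t ^ p * (t - 1) ^ q : ℝ) : ℂ)) t := by
    intro t
    have h1 : HasDerivAt (fun t : ℝ => a + (t : ℂ) * b) (1 * b) t :=
      ((HasDerivAt.ofReal_comp (hasDerivAt_id t)).mul_const b).const_add a
    have h2 := (f.hasDerivAt (a + (t : ℂ) * b)).comp t h1
    refine h2.congr_deriv ?_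
    rw [hf, hn]
    simp only [eval_mul, eval_pow, eval_sub, eval_X, eval_C]
    have e1 : a + (t : ℂ) * b - a = t * b := by ring
    have e2 : a + (t : ℂ) * b - (a + b) = (t - 1) * b := by ring
    rw [e1, e2, mul_pow, mul_pow]
    push_cast
    ring
  have hc : Continuous (fun t : ℝ => (n : ℂ) * b ^ n * ((t ^ p * (t - 1) ^ q : ℝ) : ℂ)) := by
    fun_prop
  have key := intervalIntegral.integral_eq_sub_of_hasDerivAt (a := 0) (b := 1)
    (fun t _ => hd t) (hc.intervalIntegrable 0 1)
  rw [intervalIntegral.integral_const_mul, intervalIntegral.integral_ofReal] at key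
  simp only [Complex.ofReal_one, Complex.ofReal_zero, one_mul, zero_mul, add_zero] at key
  rw [← key]
  ring
end

section
/- Fix integers p, q ≥ 1 and set n = p + q + 1 and μ = n ∫₀¹ t^p (t - 1)^q dt (viewed as a complex number). Let f be a polynomial over ℂ with derivative f'(X) = n X^p (X - 1)^q and f(0) = 0. Then the set of roots of f' is exactly {0, 1}, the set of critical values of f, i.e. {f(z) : f'(z) = 0}, is exactly {0, μ}, and 0 ≠ μ. Consequently, for c ∈ ℂ, the polynomial f - c has no critical value equal to 0 if and only if c ∉ {0, μ}. -/
open Polynomial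

/-- For `p, q ≥ 1`, `n = p + q + 1`, `μ = n ∫₀¹ t^p (t-1)^q dt` (viewed
as a complex number), and `f ∈ ℂ[X]` with `f' = n X^p (X - 1)^q` and `f(0) = 0`: the roots
of `f'` are exactly `{0, 1}`, the critical values of `f` are exactly `{0, μ}`, `0 ≠ μ`, and
for `c : ℂ` the polynomial `f - c` has no critical value equal to `0` iff `c ∉ {0, μ}`. -/
theorem critical_values_of_basepoint_polynomial (p q : ℕ) (hp : 1 ≤ p) (hq : 1 ≤ q)
    (n : ℕ) (hn : n = p + q + 1) (μ : ℂ)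
    (hμ : μ = (n : ℂ) * ((∫ t in (0:ℝ)..1, t ^ p * (t - 1) ^ q : ℝ) : ℂ))
    (f : Polynomial ℂ) (hf : f.derivative = C (n : ℂ) * X ^ p * (X - 1) ^ q)
    (h0 : f.eval 0 = 0) :
    {z : ℂ | f.derivative.eval z = 0} = {0, 1} ∧
    {w : ℂ | ∃ z : ℂ, f.derivative.eval z = 0 ∧ f.eval z = w} = {0, μ} ∧
    (0 : ℂ) ≠ μ ∧
    ∀ c : ℂ, (∀ z : ℂ, f.derivative.eval z = 0 → f.eval z - c ≠ 0) ↔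
      c ∉ ({0, μ} : Set ℂ) := by
  have hn0 : (n : ℂ) ≠ 0 := by
    rw [hn]; exact Nat.cast_ne_zero.mpr (by omega)
  have hroot : ∀ z : ℂ, f.derivative.eval z = 0 ↔ z = 0 ∨ z = 1 := by
    intro z
    have hp' : p ≠ 0 := by omega
    have hq' : q ≠ 0 := by omega
    simp [hf, hn0, hp', hq', sub_eq_zero]
  have h1 : f.eval 1 = μ := by
    have hd : ∀ t ∈ Set.uIcc (0 : ℝ) 1, HasDerivAt (fun t : ℝ => f.eval (t : ℂ))
        (f.derivative.eval (t : ℂ)) t := by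
      intro t _
      exact (f.hasDerivAt (t : ℂ)).comp_ofReal
    have hint := intervalIntegral.integral_eq_sub_of_hasDerivAt hd
      (Continuous.intervalIntegrable (by fun_prop) _ _)
    have h2 : f.eval 1 = ∫ t in (0 : ℝ)..1, f.derivative.eval (t : ℂ) := by
      rw [hint]; simp [h0]
    rw [h2, hμ, ← intervalIntegral.integral_ofReal, ← intervalIntegral.integral_const_mul]
    congr 1
    funext t
    simp [hf, mul_assoc]
  have hne : (0 : ℂ) ≠ μ := by
    have hpos : 0 < ∫ t in (0 : ℝ)..1, t ^ p * (1 - t) ^ q := by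
      apply intervalIntegral.intervalIntegral_pos_of_pos_on
      · exact Continuous.intervalIntegrable (by fun_prop) _ _
      · intro t ht
        have h3 : 0 < t := ht.1
        have h4 : 0 < 1 - t := sub_pos.mpr ht.2
        positivity
      · norm_num
    have heq : (∫ t in (0 : ℝ)..1, t ^ p * (t - 1) ^ q)
        = (-1) ^ q * ∫ t in (0 : ℝ)..1, t ^ p * (1 - t) ^ q := by
      rw [← intervalIntegral.integral_const_mul]
      congr 1
      funext t
      rw [show t - 1 = (-1) * (1 - t) by ring, mul_pow]
      ring
    rw [hμ, heq]
    refine (mul_ne_zero hn0 (Complex.ofReal_ne_zero.mpr (mul_ne_zero ?_ hpos.ne'))).symm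
    exact pow_ne_zero _ (by norm_num)
  refine ⟨?_, ?_, hne, ?_⟩
  · ext z
    simp [hroot]
  · ext w
    simp [hroot, h0, h1, eq_comm]
  · intro c
    simp [hroot, h0, h1, sub_eq_zero, eq_comm]
end

section
/- Fix integers p, q ≥ 1, set n = p + q + 1, and let μ = n ∫₀¹ t^p (t - 1)^q dt (viewed as complex). Let S = {(a, b, c) ∈ ℂ³ : b ≠ 0, c ≠ 0, μ b^n + c ≠ 0} with the subspace topology. Then the fundamental group of S (at any basepoint) is isomorphic to F₂ × ℤ, the direct product of the free group on two generators with the integers. -/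
section Helpers

open Set Topology

/-- A cover of `X` by two simply connected open sets whose intersection is a disjoint union of
path-connected open pieces indexed by `Option I`. -/
structure TwoCover (X I : Type) [TopologicalSpace X] where
  U : Bool → Set X
  isOpen_U : ∀ b, IsOpen (U b)
  cover : ∀ x, ∃ b, x ∈ U b
  sc : ∀ b, IsSimplyConnected (U b)
  w : X → Option I
  isOpen_w : ∀ k, IsOpen {x | (∀ b, x ∈ U b) ∧ w x = k}
  pc_w : ∀ k, IsPathConnected {x | (∀ b, x ∈ U b) ∧ w x = k}

namespace TwoCover

variable {X I : Type} [TopologicalSpace X] (C : TwoCover X I)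

theorem exists_path (b : Bool) {x y : X} (hx : x ∈ C.U b) (hy : y ∈ C.U b) :
    ∃ γ : Path x y, ∀ t, γ t ∈ C.U b := by
  obtain ⟨γ, h⟩ := (C.sc b).isPathConnected.joinedIn x hx y hy
  exact ⟨γ, h⟩

theorem path_unique (b : Bool) {x y : X} (γ γ' : Path x y) (h : ∀ t, γ t ∈ C.U b)
    (h' : ∀ t, γ' t ∈ C.U b) :
    Path.Homotopic.Quotient.mk γ = Path.Homotopic.Quotient.mk γ' := by
  have := (C.sc b).simplyConnectedSpace
  have hx : x ∈ C.U b := by simpa using h 0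
  have hy : y ∈ C.U b := by simpa using h 1
  let δ : Path (⟨x, hx⟩ : C.U b) ⟨y, hy⟩ :=
    { toFun := fun t => ⟨γ t, h t⟩, source' := by simp, target' := by simp }
  let δ' : Path (⟨x, hx⟩ : C.U b) ⟨y, hy⟩ :=
    { toFun := fun t => ⟨γ' t, h' t⟩, source' := by simp, target' := by simp }
  have H := (SimplyConnectedSpace.paths_homotopic δ δ').map (⟨Subtype.val, continuous_subtype_val⟩ : C(C.U b, X))
  exact Path.Homotopic.Quotient.eq.2 H

section cov
variable {G : Type} [Group G] (t : Option I → G)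

open Classical in
/-- cocycle potential -/
noncomputable def pot (b : Bool) (x : X) : G := if b then t (C.w x) else 1

theorem locconst [TopologicalSpace G] [DiscreteTopology G] (i j : Bool) :
    ContinuousOn (fun x : X => (C.pot t j x)⁻¹ * C.pot t i x) (C.U i ∩ C.U j) := by
  by_cases hij : i = j
  · subst hij; simp only [inv_mul_cancel]; exact continuousOn_const
  · intro x hx
    have hx' : ∀ b, x ∈ C.U b := by
      intro b; cases i <;> cases j <;> cases b <;> simp_all
    have : ∀ᶠ y in 𝓝 x, C.w y = C.w x := by
      filter_upwards [(C.isOpen_w (C.w x)).mem_nhds ⟨hx', rfl⟩] with y hy using hy.2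
    apply ContinuousAt.continuousWithinAt
    refine (continuousAt_const (y := (C.pot t j x)⁻¹ * C.pot t i x)).congr ?_
    filter_upwards [this] with y hy
    simp [pot, hy]

/-- the bundle -/
noncomputable def core [TopologicalSpace G] [DiscreteTopology G] : FiberBundleCore Bool X G where
  baseSet := C.U
  isOpen_baseSet := C.isOpen_U
  indexAt x := (C.cover x).choose
  mem_baseSet_at x := (C.cover x).choose_spec
  coordChange i j x v := (C.pot t j x)⁻¹ * C.pot t i x * v
  coordChange_self i x hx v := by simp
  continuousOn_coordChange i j := by
    have h1 := (C.locconst t i j).comp (s := (C.U i ∩ C.U j) ×ˢ (univ : Set G)) continuousOn_fst (fun p hp => hp.1)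
    exact (continuous_mul (M := G)).comp_continuousOn (h1.prodMk continuousOn_snd)
  coordChange_comp i j k x hx v := by group

theorem exists_cov : ∃ (E : Type) (_ : TopologicalSpace E) (p : E → X) (_ : IsCoveringMap p)
    (e : Bool → X → G → E), (∀ b x v, p (e b x v) = x) ∧
    (∀ b v, ContinuousOn (fun x => e b x v) (C.U b)) ∧
    (∀ x v, e true x v = e false x (t (C.w x) * v)) ∧
    (∀ b x, Function.Injective (e b x)) := by
  let _ : TopologicalSpace G := ⊥
  have : DiscreteTopology G := ⟨rfl⟩
  let Z := C.core t
  refine ⟨Z.TotalSpace, inferInstance, Z.proj, FiberBundle.isCoveringMap (F := G) (E := Z.Fiber),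
    fun b x v => (Z.localTriv b).toOpenPartialHomeomorph.symm (x, v), ?_, ?_, ?_, ?_⟩
  · intro b x v; rfl
  · intro b v
    refine (Z.localTriv b).toOpenPartialHomeomorph.continuousOn_symm.comp
      (f := fun x => (x, v)) (by fun_prop) ?_
    intro x hx
    exact (Z.mem_localTriv_target b (x, v)).2 hx
  · intro x v
    simp only [FiberBundleCore.localTriv_symm_apply]
    congr 1
    change (C.pot t _ x)⁻¹ * C.pot t _ x * _ = (C.pot t _ x)⁻¹ * C.pot t _ x * _
    simp [pot, mul_assoc]
  · intro b x v v' h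
    simp only [FiberBundleCore.localTriv_symm_apply] at h
    have : (C.pot t _ x)⁻¹ * C.pot t _ x * _ = (C.pot t _ x)⁻¹ * C.pot t _ x * _ := eq_of_heq (Bundle.TotalSpace.mk.inj h).2
    exact mul_left_cancel this

end cov

open Path.Homotopic.Quotient in
theorem gpd_aux {p x y : X} (a s : Path.Homotopic.Quotient p x) (d : Path.Homotopic.Quotient x y)
    (u u' : Path.Homotopic.Quotient p y) (h : s.trans d = u) :
    (a.trans d).trans u'.symm = (a.trans s.symm).trans (u.trans u'.symm) := by
  subst h
  simp only [trans_assoc]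
  rw [← trans_assoc s.symm s, symm_trans, refl_trans]

open Path.Homotopic.Quotient in
theorem gpd_aux2 {p x y : X} (s s' : Path.Homotopic.Quotient p x) (d : Path.Homotopic.Quotient x y) :
    (s.trans d).trans (s'.trans d).symm = s.trans s'.symm := by
  have h : (s'.trans d).symm = d.symm.trans s'.symm := by
    have h1 : (s'.trans d).trans (d.symm.trans s'.symm) = Path.Homotopic.Quotient.refl _ := by
      rw [trans_assoc, ← trans_assoc d, trans_symm, refl_trans, trans_symm]
    calc (s'.trans d).symm = (s'.trans d).symm.trans ((s'.trans d).trans (d.symm.trans s'.symm)) := by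
          rw [h1, trans_refl]
      _ = _ := by rw [← trans_assoc, symm_trans, refl_trans]
  rw [h, trans_assoc, ← trans_assoc d, trans_symm, refl_trans]

/-- chosen base points -/
noncomputable def base (k : Option I) : X := (C.pc_w k).nonempty.choose

theorem base_spec (k : Option I) : (∀ b, C.base k ∈ C.U b) ∧ C.w (C.base k) = k :=
  (C.pc_w k).nonempty.choose_spec

/-- standard paths -/
noncomputable def std (b : Bool) (x : X) (hx : x ∈ C.U b) : Path (C.base none) x :=
  (C.exists_path b ((C.base_spec none).1 b) hx).choose

theorem std_spec (b : Bool) (x : X) (hx : x ∈ C.U b) : ∀ t, C.std b x hx t ∈ C.U b :=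
  (C.exists_path b ((C.base_spec none).1 b) hx).choose_spec

/-- class of a standard path -/
noncomputable def cstd (b : Bool) (x : X) (hx : x ∈ C.U b) :
    Path.Homotopic.Quotient (C.base none) x := .mk (C.std b x hx)

theorem cstd_trans (b : Bool) {x y : X} (hx : x ∈ C.U b) (hy : y ∈ C.U b) (γ : Path x y)
    (h : ∀ t, γ t ∈ C.U b) : (C.cstd b x hx).trans (.mk γ) = C.cstd b y hy := by
  unfold cstd
  rw [← Path.Homotopic.Quotient.mk_trans]
  apply C.path_unique b
  · have h1 : range ((C.std b x hx).trans γ) ⊆ C.U b := by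
      rw [Path.trans_range]
      rintro _ (⟨t, rfl⟩ | ⟨t, rfl⟩)
      · exact C.std_spec b x hx t
      · exact h t
    exact fun t => h1 ⟨t, rfl⟩
  · exact C.std_spec b y hy

theorem cstd_base (b : Bool) : C.cstd b (C.base none) ((C.base_spec none).1 b) = .refl _ := by
  rw [← Path.Homotopic.Quotient.mk_refl]
  exact C.path_unique b _ _ (C.std_spec _ _ _) (fun t => (C.base_spec none).1 b)

/-- loops -/
noncomputable def loop (k : Option I) : FundamentalGroup X (C.base none) :=
  (C.cstd true (C.base k) ((C.base_spec k).1 _)).trans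
    (C.cstd false (C.base k) ((C.base_spec k).1 _)).symm

theorem loop_none : C.loop none = 1 := by
  rw [loop, cstd_base, cstd_base, FundamentalGroup.one_def, Path.Homotopic.Quotient.trans_symm]

/-- the comparison map -/
noncomputable def phi : FreeGroup I →* FundamentalGroup X (C.base none) :=
  FreeGroup.lift fun i => C.loop (some i)

theorem loop_mem (k : Option I) : C.loop k ∈ C.phi.range := by
  cases k with
  | none => rw [loop_none]; exact one_mem _
  | some i => exact ⟨FreeGroup.of i, by simp [phi]⟩

theorem loop_eq (x : X) (hx : ∀ b, x ∈ C.U b) :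
    (C.cstd true x (hx _)).trans (C.cstd false x (hx _)).symm = C.loop (C.w x) := by
  obtain ⟨δ, hδ⟩ := (C.pc_w (C.w x)).joinedIn (C.base (C.w x)) (C.base_spec _) x ⟨hx, rfl⟩
  rw [← C.cstd_trans true ((C.base_spec _).1 _) (hx true) δ (fun t => (hδ t).1 _),
    ← C.cstd_trans false ((C.base_spec _).1 _) (hx false) δ (fun t => (hδ t).1 _), gpd_aux2]
  rfl

theorem switch (b b' : Bool) (x : X) (hx : x ∈ C.U b) (hx' : x ∈ C.U b') :
    ((C.cstd b x hx).trans (C.cstd b' x hx').symm : FundamentalGroup X (C.base none))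
      ∈ C.phi.range := by
  by_cases hb : b = b'
  · subst hb
    rw [Path.Homotopic.Quotient.trans_symm]
    exact one_mem C.phi.range
  · have hall : ∀ c, x ∈ C.U c := by
      intro c; cases b <;> cases b' <;> cases c <;> simp_all
    have h1 := C.loop_eq x hall
    have h2 := C.loop_mem (C.w x)
    match b, b', hb with
    | true, true, hb => exact absurd rfl hb
    | false, false, hb => exact absurd rfl hb
    | false, true, _ =>
      have h3 := C.phi.range.inv_mem h2
      have h5 : (C.loop (C.w x)).trans ((C.cstd false x (hall _)).trans (C.cstd true x (hall _)).symm)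
          = Path.Homotopic.Quotient.refl (C.base none) := by
        rw [← h1, ← gpd_aux (u := C.cstd false x (hall _)) (d := .refl x),
          Path.Homotopic.Quotient.trans_refl, Path.Homotopic.Quotient.trans_symm]
        rw [Path.Homotopic.Quotient.trans_refl]
      have h4 : ((C.cstd false x (hall _)).trans (C.cstd true x (hall _)).symm :
          FundamentalGroup X (C.base none)) = (C.loop (C.w x))⁻¹ :=
        (eq_inv_iff_mul_eq_one (G := FundamentalGroup X (C.base none))).2 h5
      rw [h4]; exact h3
    | true, false, _ => rw [h1]; exact h2

/-- tracked property -/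
def P (x : X) (α : Path.Homotopic.Quotient (C.base none) x) : Prop :=
  ∀ b (hx : x ∈ C.U b), (α.trans (C.cstd b x hx).symm : FundamentalGroup X (C.base none))
    ∈ C.phi.range

theorem P_step {x y : X} (α : Path.Homotopic.Quotient (C.base none) x) (h : C.P x α)
    (b : Bool) (δ : Path x y) (hδ : ∀ t, δ t ∈ C.U b) : C.P y (α.trans (.mk δ)) := by
  intro b' hy'
  have hx : x ∈ C.U b := by simpa using hδ 0
  have hy : y ∈ C.U b := by simpa using hδ 1
  rw [gpd_aux α (C.cstd b x hx) (.mk δ) _ _ (C.cstd_trans b hx hy δ hδ)]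
  exact C.phi.range.mul_mem (C.switch b b' y hy hy') (h b hx)

theorem P_cast {x y : X} (hxy : x = y) (α : Path.Homotopic.Quotient (C.base none) x)
    (h : C.P x α) : C.P y (α.cast rfl hxy.symm) := by
  subst hxy
  simpa using h

theorem P_base (γ : Path (C.base none) (C.base none)) : C.P _ (.mk γ) := by
  obtain ⟨t, t0, tm, ⟨N, hN⟩, ht⟩ := exists_monotone_Icc_subset_open_cover_unitInterval
    (c := fun b => γ ⁻¹' (C.U b)) (fun b => (C.isOpen_U b).preimage γ.continuous)
    (fun x _ => by simpa using C.cover (γ x))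
  have key : ∀ n, C.P (γ (t n)) ((Path.Homotopic.Quotient.mk (γ.subpath 0 (t n))).cast γ.source.symm rfl) := by
    intro n
    induction n with
    | zero =>
      intro b hx
      rw [← Path.Homotopic.Quotient.mk_cast]
      have hb : ∀ (s : unitInterval) (hs : s = 0) (hx : γ s ∈ C.U b),
        ((Path.Homotopic.Quotient.mk ((γ.subpath 0 s).cast γ.source.symm rfl)).trans (C.cstd b (γ s) hx).symm) = .refl _ := by
        intro s hs
        subst hs
        intro hx
        have hb0 := (C.base_spec none).1 b
        have hr : ∀ r, ((γ.subpath 0 0).cast γ.source.symm rfl) r ∈ C.U b := by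
          intro r; simpa using hx
        rw [← C.cstd_trans b hb0 hx _ hr, cstd_base, Path.Homotopic.Quotient.refl_trans,
          Path.Homotopic.Quotient.trans_symm]
      rw [hb (t 0) t0 hx]
      exact one_mem C.phi.range
    | succ n ih =>
      obtain ⟨b, hb⟩ := ht n
      have h1 := C.P_step _ ih b (γ.subpath (t n) (t (n+1))) (by
        intro s
        have : γ.subpath (t n) (t (n+1)) s ∈ range (γ.subpath (t n) (t (n+1))) := ⟨s, rfl⟩
        rw [Path.range_subpath_of_le _ _ _ (tm (Nat.le_succ n))] at this
        obtain ⟨r, hr, h⟩ := this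
        rw [← h]; exact hb hr)
      convert h1 using 1
      rw [← Path.Homotopic.Quotient.mk_cast, ← Path.Homotopic.Quotient.mk_cast, ← Path.Homotopic.Quotient.mk_trans]
      have := (Path.Homotopy.subpathTransSubpath γ 0 (t n) (t (n+1)))
      exact (Path.Homotopic.Quotient.eq.2 ⟨this.pathCast γ.source.symm rfl⟩).symm
  have hk := key N
  rw [← Path.Homotopic.Quotient.mk_cast] at hk
  have : ∀ (s : unitInterval) (hs : s = 1), C.P (γ s) (.mk ((γ.subpath 0 s).cast γ.source.symm rfl)) →
      C.P _ (.mk γ) := by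
    intro s hs h
    subst hs
    rw [Path.subpath_zero_one] at h
    have h2 := C.P_cast γ.target _ h
    rw [← Path.Homotopic.Quotient.mk_cast] at h2
    exact h2
  exact this (t N) (hN N le_rfl) hk

theorem phi_surj : Function.Surjective C.phi := by
  intro g
  induction g using Path.Homotopic.Quotient.ind with
  | mk γ =>
    have := C.P_base γ true ((C.base_spec none).1 _)
    rw [cstd_base] at this
    have h2 : ((Path.Homotopic.Quotient.mk γ).trans (Path.Homotopic.Quotient.refl (C.base none)).symm)
      = Path.Homotopic.Quotient.mk γ := by
      have : (Path.Homotopic.Quotient.refl (C.base none)).symm = Path.Homotopic.Quotient.refl _ := by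
        rw [← Path.Homotopic.Quotient.mk_refl, ← Path.Homotopic.Quotient.mk_symm, Path.refl_symm]
      rw [this, Path.Homotopic.Quotient.trans_refl]
    rw [h2] at this
    exact this

theorem phi_inj : Function.Injective C.phi := by
  let tt : Option I → FreeGroup I := fun k => k.elim 1 FreeGroup.of
  obtain ⟨E, _, p, cov, e, hp, hc, htr, hinj⟩ := C.exists_cov tt
  have hpm : ∀ b x v, e b x v ∈ p ⁻¹' {x} := hp
  have mono : ∀ (b : Bool) (x y : X) (γ : Path x y) (_ : ∀ s, γ s ∈ C.U b) (v : FreeGroup I),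
      cov.monodromy (.mk γ) ⟨e b x v, hpm b x v⟩ = ⟨e b y v, hpm b y v⟩ := by
    intro b x y γ hγ v
    let Γ : Path (e b x v) (e b y v) :=
      { toFun := fun s => e b (γ s) v
        continuous_toFun := (hc b v).comp_continuous γ.continuous hγ
        source' := by simp
        target' := by simp }
    apply cov.monodromy_eq_of_map_eq (.mk Γ)
    exact congrArg Path.Homotopic.Quotient.mk (Path.ext (funext fun s => hp _ _ _))
  have hloop : ∀ k v, cov.monodromy (C.loop k) ⟨e true _ v, hpm _ _ v⟩ = ⟨e true _ (tt k * v), hpm _ _ _⟩ := by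
    intro k v
    rw [loop, cov.monodromy_trans_apply]
    unfold cstd
    rw [← Path.Homotopic.Quotient.mk_symm, mono true _ _ _ (C.std_spec _ _ _)]
    have h1 : (⟨e true (C.base k) v, hpm _ _ _⟩ : p ⁻¹' {C.base k}) =
      ⟨e false (C.base k) (tt k * v), hpm _ _ _⟩ := by
      apply Subtype.ext
      change e true (C.base k) v = _
      rw [htr, (C.base_spec k).2]
    rw [h1, mono false _ _ (C.std false (C.base k) ((C.base_spec k).1 _)).symm (fun s => C.std_spec _ _ _ _)]
    apply Subtype.ext
    change e false _ _ = e true _ _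
    rw [htr, (C.base_spec none).2]
    simp [tt]
  have hphi : ∀ g v, cov.monodromyPerm _ (C.phi g) ⟨e true _ v, hpm _ _ v⟩ =
      ⟨e true _ (g * v), hpm _ _ _⟩ := by
    intro g
    induction g using FreeGroup.induction_on with
    | C1 => intro v; rw [map_one, map_one]; apply Subtype.ext; simp
    | of i => intro v; simpa [phi, tt] using hloop (some i) v
    | inv_of i ih =>
      intro v
      rw [map_inv, map_inv, Equiv.Perm.inv_eq_iff_eq, ih]
      simp
    | mul g h hg hh =>
      intro v
      rw [map_mul, map_mul, Equiv.Perm.mul_apply, hh, hg, mul_assoc]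
  rw [injective_iff_map_eq_one]
  intro g hg
  have := hphi g 1
  rw [hg, map_one, Equiv.Perm.one_apply] at this
  have := hinj _ _ (congrArg Subtype.val this)
  simpa using this.symm

/-- The fundamental group is free on `I`. -/
noncomputable def equiv : FreeGroup I ≃* FundamentalGroup X (C.base none) :=
  MulEquiv.ofBijective C.phi ⟨C.phi_inj, C.phi_surj⟩

end TwoCover

theorem TwoCover.pathConnected {X I : Type} [TopologicalSpace X] (C : TwoCover X I) :
    PathConnectedSpace X := by
  have key : ∀ x, Joined (C.base none) x := by
    intro x
    obtain ⟨b, hb⟩ := C.cover x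
    exact ⟨C.std b x hb⟩
  exact ⟨⟨C.base none⟩, fun x y => (key x).symm.trans (key y)⟩

theorem TwoCover.nonempty_equiv {X I : Type} [TopologicalSpace X] (C : TwoCover X I) (x : X) :
    Nonempty (FundamentalGroup X x ≃* FreeGroup I) := by
  have := C.pathConnected
  exact ⟨(FundamentalGroup.fundamentalGroupMulEquivOfPathConnected x (C.base none)).trans
    C.equiv.symm⟩

/-- The plane punctured at a set of real points. -/
abbrev PP (P : Set ℝ) : Type := {z : ℂ // ¬ (z.im = 0 ∧ z.re ∈ P)}

/-- sign -/
def sg (b : Bool) : ℝ := if b then 1 else -1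

theorem sg_mul (b : Bool) : sg b * sg b = 1 := by cases b <;> simp [sg]

/-- slit plane -/
def slit (P : Set ℝ) (b : Bool) : Set (PP P) := {z | z.1.re ∉ P ∨ 0 < sg b * z.1.im}

/-- constructor for points of the slit plane -/
noncomputable def slitMk {P : Set ℝ} {b : Bool} (x y : ℝ) (h : x ∉ P ∨ 0 < sg b * y) :
    slit P b :=
  ⟨⟨(x : ℂ) + (y : ℂ) * Complex.I, by
    rintro ⟨h1, h2⟩
    simp at h1 h2
    rcases h with h | h
    · exact h h2
    · simp [h1] at h⟩, by
    simpa [slit] using h⟩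

theorem slit_mem {P : Set ℝ} {b : Bool} (u : slit P b) :
    u.1.1.re ∉ P ∨ 0 < sg b * u.1.1.im := u.2

theorem slitMk_self {P : Set ℝ} {b : Bool} (u : slit P b) (x y : ℝ) (h : x ∉ P ∨ 0 < sg b * y)
    (hx : x = u.1.1.re) (hy : y = u.1.1.im) : slitMk x y h = u := by
  subst hx hy
  apply Subtype.ext
  apply Subtype.ext
  exact Complex.re_add_im _

theorem slitMk_cont {P : Set ℝ} {b : Bool} {T : Type} [TopologicalSpace T] (x y : T → ℝ)
    (h : ∀ s, x s ∉ P ∨ 0 < sg b * y s) (hx : Continuous x) (hy : Continuous y) :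
    Continuous (fun s => slitMk (x s) (y s) (h s) : T → slit P b) := by
  unfold slitMk
  apply Continuous.subtype_mk
  apply Continuous.subtype_mk
  fun_prop

theorem slit_contractible (P : Set ℝ) (b : Bool) : ContractibleSpace (slit P b) := by
  rw [contractible_iff_id_nullhomotopic]
  have hs := sg_mul b
  let f1 : C(slit P b, slit P b) :=
    ⟨fun u => slitMk u.1.1.re (sg b * (|u.1.1.im| + 1))
      (Or.inr (by rw [← mul_assoc, hs]; positivity)), by
      apply slitMk_cont <;> fun_prop⟩
  have H1 : (ContinuousMap.id (slit P b)).Homotopic f1 := by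
    refine ⟨⟨⟨fun q => slitMk q.2.1.1.re
      ((1 - q.1.1) * q.2.1.1.im + q.1.1 * (sg b * (|q.2.1.1.im| + 1))) ?_, ?_⟩, ?_, ?_⟩⟩
    · rcases slit_mem q.2 with h | h
      · exact Or.inl h
      · right
        have e : sg b * ((1 - q.1.1) * q.2.1.1.im + q.1.1 * (sg b * (|q.2.1.1.im| + 1))) =
          (1 - q.1.1) * (sg b * q.2.1.1.im) + q.1.1 * (|q.2.1.1.im| + 1) := by
          linear_combination (q.1.1 * (|q.2.1.1.im| + 1)) * hs
        rw [e]
        have h0 := q.1.2.1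
        have h1 := q.1.2.2
        rcases h0.eq_or_lt with h0 | h0
        · rw [← h0]; simpa using h
        · have : 0 ≤ (1 - q.1.1) * (sg b * q.2.1.1.im) := mul_nonneg (by linarith) h.le
          positivity
    · apply slitMk_cont <;> fun_prop
    · intro u
      apply slitMk_self
      · simpa using slit_mem u
      · rfl
      · simp
    · intro u
      simp [f1]
  have H2 : f1.Homotopic (ContinuousMap.const _ (slitMk 0 (sg b) (Or.inr (by rw [hs]; simp)))) := by
    refine ⟨⟨⟨fun q => slitMk ((1 - q.1.1) * q.2.1.1.re)
      (sg b * ((1 - q.1.1) * |q.2.1.1.im| + 1)) ?_, ?_⟩, ?_, ?_⟩⟩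
    · right
      rw [← mul_assoc, hs]
      have : 0 ≤ 1 - q.1.1 := by linarith [q.1.2.2]
      positivity
    · apply slitMk_cont <;> fun_prop
    · intro u
      simp [f1]
    · intro u
      simp
  exact ⟨_, H1.trans H2⟩

theorem slit_all {P : Set ℝ} (z : PP P) : (∀ b, z ∈ slit P b) ↔ z.1.re ∉ P := by
  constructor
  · intro h hP
    have h1 := h true
    have h2 := h false
    simp [slit, sg, hP] at h1 h2
    linarith
  · intro h b
    exact Or.inl h

/-- the cover of the punctured plane -/
noncomputable def ppCover {I : Type} (P : Set ℝ) (hP : IsClosed P) (v : ℝ → Option I)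
    (hv : ∀ k, IsOpen {x | x ∉ P ∧ v x = k}) (hc : ∀ k, Convex ℝ {x | x ∉ P ∧ v x = k})
    (hn : ∀ k, {x | x ∉ P ∧ v x = k}.Nonempty) : TwoCover (PP P) I where
  U := slit P
  isOpen_U b := by
    have h1 : IsOpen {z : PP P | z.1.re ∉ P} :=
      hP.isOpen_compl.preimage (by fun_prop : Continuous fun z : PP P => z.1.re)
    have h2 : IsOpen {z : PP P | 0 < sg b * z.1.im} :=
      isOpen_lt continuous_const (by fun_prop)
    exact h1.union h2
  cover z := by
    by_cases h : z.1.re ∈ P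
    · have h1 : z.1.im ≠ 0 := fun h0 => z.2 ⟨h0, h⟩
      rcases h1.lt_or_gt with h1 | h1
      · exact ⟨false, Or.inr (by simpa [sg] using h1)⟩
      · exact ⟨true, Or.inr (by simpa [sg] using h1)⟩
    · exact ⟨true, Or.inl h⟩
  sc b := by
    have := slit_contractible P b
    exact (inferInstance : SimplyConnectedSpace (slit P b))
  w z := v z.1.re
  isOpen_w k := by
    simp only [slit_all]
    exact (hv k).preimage (by fun_prop : Continuous fun z : PP P => z.1.re)
  pc_w k := by
    simp only [slit_all]
    refine (Topology.IsInducing.isPathConnected_iff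
      (f := (Subtype.val : PP P → ℂ)) ⟨rfl⟩).2 ?_
    have : (Subtype.val '' {x : PP P | x.1.re ∉ P ∧ v x.1.re = k} : Set ℂ) =
        Complex.reLm ⁻¹' {x | x ∉ P ∧ v x = k} := by
      ext z
      simp only [mem_image, mem_ofPred_eq, mem_preimage, Complex.reLm_coe]
      constructor
      · rintro ⟨y, h, rfl⟩; exact h
      · intro h; exact ⟨⟨z, fun h' => h.1 h'.2⟩, h, rfl⟩
    rw [this]
    refine ((hc k).linear_preimage _).isPathConnected ?_
    obtain ⟨x, hx⟩ := hn k
    exact ⟨(x : ℂ), by simpa using hx⟩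

theorem pi1_once (x : PP {0}) : Nonempty (FundamentalGroup (PP {0}) x ≃* FreeGroup Unit) := by
  let v : ℝ → Option Unit := fun x => if x < 0 then none else some ()
  have h : ∀ k, {x | x ∉ ({0} : Set ℝ) ∧ v x = k} = k.elim (Iio 0) (fun _ => Ioi 0) := by
    intro k
    ext x
    rcases k with _ | _ <;> simp only [v, mem_ofPred_eq, Option.elim] <;> grind
  refine (ppCover {0} isClosed_singleton v ?_ ?_ ?_).nonempty_equiv x <;>
  · intro k
    rw [h]
    rcases k with _ | _
    · simp [isOpen_Iio, convex_Iio]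
    · simp [isOpen_Ioi, convex_Ioi]

theorem pi1_twice (x : PP {0, -1}) :
    Nonempty (FundamentalGroup (PP {0, -1}) x ≃* FreeGroup Bool) := by
  let v : ℝ → Option Bool := fun x =>
    if x < -1 then none else if x < 0 then some true else some false
  have h : ∀ k, {x | x ∉ ({0, -1} : Set ℝ) ∧ v x = k} =
      k.elim (Iio (-1)) (fun b => if b then Ioo (-1) 0 else Ioi 0) := by
    intro k
    ext x
    rcases k with _ | _ | _ <;> simp only [v, mem_ofPred_eq, Option.elim] <;> grind
  refine (ppCover {0, -1} (Set.toFinite _).isClosed v ?_ ?_ ?_).nonempty_equiv x <;>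
  · intro k
    rw [h]
    rcases k with _ | _ | _
    · simp [isOpen_Iio, convex_Iio]
    · simp [isOpen_Ioi, convex_Ioi]
    · simp [isOpen_Ioo, convex_Ioo]

/-- fundamental group of a product -/
noncomputable def pi1Prod {A B : Type} [TopologicalSpace A] [TopologicalSpace B] (a : A) (b : B) :
    FundamentalGroup A a × FundamentalGroup B b ≃* FundamentalGroup (A × B) (a, b) where
  toFun q := Path.Homotopic.prod (α := A) (β := B) q.1 q.2
  invFun q := (Path.Homotopic.projLeft q, Path.Homotopic.projRight q)
  left_inv q := Prod.ext (Path.Homotopic.projLeft_prod _ _) (Path.Homotopic.projRight_prod _ _)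
  right_inv q := Path.Homotopic.prod_projLeft_projRight q
  map_mul' q r := (Path.Homotopic.comp_prod_eq_prod_comp _ _ _ _).symm

/-- homeomorphism invariance -/
noncomputable def pi1Homeo {A B : Type} [TopologicalSpace A] [TopologicalSpace B] (e : A ≃ₜ B)
    (a : A) : FundamentalGroup A a ≃* FundamentalGroup B (e a) :=
  (FundamentalGroupoidFunctor.equivOfHomotopyEquiv e.toHomotopyEquiv).fullyFaithfulFunctor.mulEquivEnd
    (FundamentalGroupoid.mk a)

theorem mu_ne (p q : ℕ) : (∫ t in (0:ℝ)..1, t ^ p * (t - 1) ^ q : ℝ) ≠ 0 := by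
  have h : ∀ t : ℝ, t ^ p * (t - 1) ^ q = (-1) ^ q * (t ^ p * (1 - t) ^ q) := by
    intro t
    rw [show t - 1 = (-1) * (1 - t) by ring, mul_pow]; ring
  simp only [h, intervalIntegral.integral_const_mul]
  refine mul_ne_zero (by simp) (ne_of_gt ?_)
  apply intervalIntegral.intervalIntegral_pos_of_pos_on
  · exact (by fun_prop : Continuous fun t : ℝ => t ^ p * (1 - t) ^ q).intervalIntegrable _ _
  · intro t ht
    have := ht.1
    have : 0 < 1 - t := by linarith [ht.2]
    positivity
  · norm_num

theorem pp0_iff (z : ℂ) : ¬ (z.im = 0 ∧ z.re ∈ ({0} : Set ℝ)) ↔ z ≠ 0 := by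
  simp [Complex.ext_iff, and_comm]

theorem pp1_iff (z : ℂ) : ¬ (z.im = 0 ∧ z.re ∈ ({0, -1} : Set ℝ)) ↔ z ≠ 0 ∧ z ≠ -1 := by
  simp [Complex.ext_iff]
  tauto

/-- the homeomorphism trivialising `S` -/
noncomputable def homeoS (μ : ℂ) (hμ : μ ≠ 0) (n : ℕ) :
    {x : ℂ × ℂ × ℂ // x.2.1 ≠ 0 ∧ x.2.2 ≠ 0 ∧ μ * x.2.1 ^ n + x.2.2 ≠ 0} ≃ₜ
      ℂ × (PP {0, -1} × PP {0}) where
  toFun x := (x.1.1, ⟨x.1.2.2 / (μ * x.1.2.1 ^ n), by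
      obtain ⟨⟨a, b, c⟩, hb, hc, h⟩ := x
      simp only at hb hc h ⊢
      rw [pp1_iff]
      have : μ * b ^ n ≠ 0 := mul_ne_zero hμ (pow_ne_zero _ hb)
      refine ⟨div_ne_zero hc this, fun h' => h ?_⟩
      rw [div_eq_iff this] at h'
      rw [h']; ring⟩, ⟨x.1.2.1, (pp0_iff _).2 x.2.1⟩)
  invFun y := ⟨(y.1, y.2.2.1, y.2.1.1 * (μ * y.2.2.1 ^ n)), by
      obtain ⟨a, ⟨w, hw⟩, ⟨b, hb⟩⟩ := y
      simp only
      rw [pp0_iff] at hb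
      rw [pp1_iff] at hw
      have : μ * b ^ n ≠ 0 := mul_ne_zero hμ (pow_ne_zero _ hb)
      refine ⟨hb, mul_ne_zero hw.1 this, fun h => hw.2 ?_⟩
      have : (1 + w) * (μ * b ^ n) = 0 := by linear_combination h
      have := (mul_eq_zero.1 this).resolve_right ‹_›
      linear_combination this⟩
  left_inv x := by
    obtain ⟨⟨a, b, c⟩, hb, hc, h⟩ := x
    simp only at hb
    have : μ * b ^ n ≠ 0 := mul_ne_zero hμ (pow_ne_zero _ hb)
    simp [div_mul_cancel₀ _ this]
  right_inv y := by
    obtain ⟨a, ⟨w, hw⟩, ⟨b, hb⟩⟩ := y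
    rw [pp0_iff] at hb
    have : μ * b ^ n ≠ 0 := mul_ne_zero hμ (pow_ne_zero _ hb)
    simp [mul_div_cancel_right₀ _ this]
  continuous_toFun := by
    refine (by fun_prop : Continuous _).prodMk (Continuous.prodMk (Continuous.subtype_mk ?_ _)
      (Continuous.subtype_mk (by fun_prop) _))
    refine Continuous.div (by fun_prop) (by fun_prop) ?_
    intro x
    exact mul_ne_zero hμ (pow_ne_zero _ x.2.1)
  continuous_invFun := by
    refine Continuous.subtype_mk ?_ _
    fun_prop

end Helpers

/-- For `p, q ≥ 1`, `n = p + q + 1`, and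
`μ = n ∫₀¹ t^p (t-1)^q dt` (viewed as complex), the fundamental group of
`S = {(a,b,c) ∈ ℂ³ : b ≠ 0, c ≠ 0, μ b^n + c ≠ 0}` at any basepoint is isomorphic to
`F₂ × ℤ`, the direct product of the free group on two generators with the integers. -/
theorem fundamental_group_of_S (p q : ℕ) (hp : 1 ≤ p) (hq : 1 ≤ q) (n : ℕ)
    (hn : n = p + q + 1) (μ : ℂ)
    (hμ : μ = (n : ℂ) * ((∫ t in (0:ℝ)..1, t ^ p * (t - 1) ^ q : ℝ) : ℂ)) :
    ∀ s : {x : ℂ × ℂ × ℂ // x.2.1 ≠ 0 ∧ x.2.2 ≠ 0 ∧ μ * x.2.1 ^ n + x.2.2 ≠ 0},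
      Nonempty (FundamentalGroup
        {x : ℂ × ℂ × ℂ // x.2.1 ≠ 0 ∧ x.2.2 ≠ 0 ∧ μ * x.2.1 ^ n + x.2.2 ≠ 0} s ≃*
        FreeGroup Bool × Multiplicative ℤ) := by
  intro s
  have hμ0 : μ ≠ 0 := by
    rw [hμ]
    refine mul_ne_zero ?_ (Complex.ofReal_ne_zero.2 (mu_ne p q))
    rw [Nat.cast_ne_zero]; omega
  let e := homeoS μ hμ0 n
  obtain ⟨f⟩ := pi1_twice (e s).2.1
  obtain ⟨g⟩ := pi1_once (e s).2.2
  have : Subsingleton (FundamentalGroup ℂ (e s).1) :=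
    (inferInstance : Subsingleton (Path.Homotopic.Quotient (e s).1 (e s).1))
  let u : Unique (FundamentalGroup ℂ (e s).1) := ⟨⟨1⟩, fun _ => Subsingleton.elim _ _⟩
  let h1 : FundamentalGroup _ s ≃* FundamentalGroup _ (e s) := pi1Homeo e s
  let h2 := (pi1Prod (e s).1 (e s).2).symm
  let h3 := (pi1Prod (e s).2.1 (e s).2.2).symm
  let h4 : FundamentalGroup ℂ (e s).1 × FundamentalGroup _ (e s).2 ≃* FundamentalGroup _ (e s).2 :=
    MulEquiv.uniqueProd
  exact ⟨h1.trans (h2.trans (h4.trans (h3.trans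
    (f.prodCongr (g.trans FreeGroup.mulEquivIntOfUnique)))))⟩
end

section
/- Let u, v, w ∈ ℂ be pairwise distinct and let f be a polynomial over ℂ whose derivative is f'(X) = 4 (X - u)(X - v)(X - w). Then f(u) = f(v) if and only if w = (u + v)/2. Consequently, the three critical values f(u), f(v), f(w) fail to be pairwise distinct if and only if one of u, v, w is the average of the other two. -/
open Polynomial

theorem eval_diff_aux (u v w : ℂ) (f : Polynomial ℂ)
    (hf : f.derivative = C 4 * (X - C u) * (X - C v) * (X - C w)) :
    f.eval v - f.eval u = (2 / 3) * (v - u) ^ 3 * (w - (u + v) / 2) := by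
  have hg : (f - (X ^ 4 - C (4 / 3 * (u + v + w)) * X ^ 3 + C (2 * (u * v + u * w + v * w)) * X ^ 2
      - C (4 * (u * v * w)) * X)).derivative = 0 := by
    apply Polynomial.funext
    intro x
    simp [hf]
    ring
  have hc := Polynomial.eq_C_of_derivative_eq_zero hg
  have h1 := congrArg (Polynomial.eval u) hc
  have h2 := congrArg (Polynomial.eval v) hc
  simp only [eval_sub, eval_add, eval_mul, eval_pow, eval_X, eval_C] at h1 h2
  linear_combination h2 - h1

theorem eval_eq_iff_aux (u v w : ℂ) (huv : u ≠ v) (f : Polynomial ℂ)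
    (hf : f.derivative = C 4 * (X - C u) * (X - C v) * (X - C w)) :
    f.eval u = f.eval v ↔ w = (u + v) / 2 := by
  have h := eval_diff_aux u v w f hf
  have hd : v - u ≠ 0 := sub_ne_zero.mpr huv.symm
  rw [eq_comm, ← sub_eq_zero, h, ← sub_eq_zero (a := w)]
  simp [hd]

/-- Let `u, v, w ∈ ℂ` be pairwise distinct and let `f ∈ ℂ[X]` satisfy
`f' = 4 (X - u)(X - v)(X - w)`.  Then `f(u) = f(v) ↔ w = (u + v)/2`; consequently the
critical values `f(u), f(v), f(w)` fail to be pairwise distinct iff one of `u, v, w` is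
the average of the other two. -/
theorem equal_critical_values_iff_midpoint (u v w : ℂ) (huv : u ≠ v) (huw : u ≠ w)
    (hvw : v ≠ w) (f : Polynomial ℂ)
    (hf : f.derivative = C 4 * (X - C u) * (X - C v) * (X - C w)) :
    (f.eval u = f.eval v ↔ w = (u + v) / 2) ∧
    (¬ (f.eval u ≠ f.eval v ∧ f.eval u ≠ f.eval w ∧ f.eval v ≠ f.eval w) ↔
      (w = (u + v) / 2 ∨ v = (u + w) / 2 ∨ u = (v + w) / 2)) := by 
  have h1 := eval_eq_iff_aux u v w huv f hf
  have h2 := eval_eq_iff_aux u w v huw f (by rw [hf]; ring)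
  have h3 := eval_eq_iff_aux v w u hvw f (by rw [hf]; ring)
  refine ⟨h1, ?_⟩
  rw [← h1, ← h2, ← h3]
  tauto
end
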